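/- Let n = 4. The abelianization H₁(C(ρ)) of the centralizer of the Nielsen automorphism ρ in Aut(F_4) is isomorphic to (ℤ/2ℤ)³. -/

import Mathlib

namespace FreeGroup

section Gromov

variable {α : Type*} [DecidableEq α]

/-- The length of the longest common prefix of two lists. -/
def commonPrefixLength {β : Type*} [DecidableEq β] : List β → List β → ℕ
  | a :: l, b :: m => if a = b then commonPrefixLength l m + 1 else 0
  | [], _ => 0
  | _ :: _, [] => 0

theorem le_commonPrefixLength_iff {β : Type*} [DecidableEq β] {k : ℕ} {l m : List β} :
    k ≤ commonPrefixLength l m ↔ k ≤ l.length ∧ k ≤ m.length ∧ l.take k = m.take k := by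
  induction l generalizing m k with
  | nil => cases k <;> simp [commonPrefixLength]
  | cons a l ih =>
    cases m with
    | nil => cases k <;> simp [commonPrefixLength]
    | cons b m =>
      cases k with
      | zero => simp
      | succ k =>
        by_cases h : a = b
        · simp [commonPrefixLength, h, ih]
        · simp [commonPrefixLength, h]

/-- The Gromov product of two elements of a free group, based at the identity. -/
def gromov (u v : FreeGroup α) : ℕ := commonPrefixLength u.toWord v.toWord

theorem le_gromov_iff {k : ℕ} {u v : FreeGroup α} :
    k ≤ gromov u v ↔ k ≤ norm u ∧ k ≤ norm v ∧ u.toWord.take k = v.toWord.take k :=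
  le_commonPrefixLength_iff

theorem gromov_comm (u v : FreeGroup α) : gromov u v = gromov v u :=
  eq_of_forall_le_iff fun k => by
    rw [le_gromov_iff, le_gromov_iff, eq_comm (a := u.toWord.take k)]; tauto

theorem gromov_le_left (u v : FreeGroup α) : gromov u v ≤ norm u :=
  (le_gromov_iff.1 le_rfl).1

theorem min_gromov_le (u v w : FreeGroup α) : min (gromov u v) (gromov v w) ≤ gromov u w := by
  have h1 := le_gromov_iff.1 (min_le_left (gromov u v) (gromov v w))
  have h2 := le_gromov_iff.1 (min_le_right (gromov u v) (gromov v w))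
  exact le_gromov_iff.2 ⟨h1.1, h2.2.1, h1.2.2.trans h2.2.2⟩

theorem toWord_mk_of_norm_eq {L : List (α × Bool)} (h : norm (mk L) = L.length) :
    (mk L).toWord = L := by
  have hs : List.Sublist (reduce L) L := Red.sublist reduce.red
  rw [toWord_mk]
  exact hs.eq_of_length (by rwa [norm, toWord_mk] at h)

theorem norm_mk_of_isReduced {L : List (α × Bool)} (h : IsReduced L) :
    norm (mk L) = L.length := by
  rw [norm, toWord_mk, h.reduce_eq]

theorem norm_inv_mul_aux (l m : List (α × Bool)) (hl : IsReduced l) (hm : IsReduced m) :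
    norm ((mk l)⁻¹ * mk m) + 2 * commonPrefixLength l m = l.length + m.length := by
  induction l generalizing m with
  | nil => simp [commonPrefixLength, ← one_eq_mk, norm_mk_of_isReduced hm]
  | cons a l ih =>
    cases m with
    | nil =>
      simp only [← one_eq_mk, mul_one, norm_inv_eq, norm_mk_of_isReduced hl]
      simp [commonPrefixLength]
    | cons b m =>
      by_cases h : a = b
      · subst h
        have := ih m hl.tail hm.tail
        have e : (mk (a :: l))⁻¹ * mk (a :: m) = (mk l)⁻¹ * mk m := by
          rw [← List.singleton_append, ← List.singleton_append (l := m), ← mul_mk, ← mul_mk]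
          group
        rw [e]
        simp only [commonPrefixLength, if_true, List.length_cons]
        lia
      · have hr : IsReduced (invRev (a :: l) ++ b :: m) := by
          have h1 : IsReduced (invRev (a :: l)) := by
            rw [← hl.reduce_eq, ← reduce_invRev]
            exact IsReduced.of_reduce_eq reduce.idem
          refine List.isChain_append.2 ⟨h1, hm, ?_⟩
          rintro ⟨x, e⟩ hx ⟨y, f⟩ hy hxy
          obtain ⟨a1, a2⟩ := a
          obtain ⟨b1, b2⟩ := b
          simp [invRev] at hx hy
          simp at hxy
          obtain ⟨rfl, rfl⟩ := hx
          obtain ⟨rfl, rfl⟩ := hy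
          subst hxy
          simp at h
          exact h
        rw [inv_mk, mul_mk, norm_mk_of_isReduced hr]
        simp [commonPrefixLength, h]

theorem norm_inv_mul (u v : FreeGroup α) :
    norm (u⁻¹ * v) + 2 * gromov u v = norm u + norm v := by
  have := norm_inv_mul_aux u.toWord v.toWord isReduced_toWord isReduced_toWord
  rwa [mk_toWord, mk_toWord] at this

theorem norm_mul (u v : FreeGroup α) :
    norm (u * v) + 2 * gromov u⁻¹ v = norm u + norm v := by
  simpa using norm_inv_mul u⁻¹ v

theorem two_mul_gromov_inv_self_le (u : FreeGroup α) : 2 * gromov u⁻¹ u ≤ norm u := by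
  by_contra! hlt
  set k := gromov u⁻¹ u with hk
  obtain ⟨h1, h2, h3⟩ := le_gromov_iff.1 hk.le
  rw [toWord_inv] at h3
  have hn : norm u = u.toWord.length := rfl
  have key (i : ℕ) (hi : i < k) (hi1 : i < u.toWord.length) :
      u.toWord[i] = ((u.toWord[u.toWord.length - 1 - i]'(by lia)).1,
        !(u.toWord[u.toWord.length - 1 - i]'(by lia)).2) := by
    have := congrArg (fun l => l[i]?) h3
    simp only [List.getElem?_take, hi, if_true] at this
    rw [List.getElem?_eq_getElem hi1, List.getElem?_eq_getElem (by simpa using hi1)] at this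
    simp only [Option.some.injEq] at this
    rw [← this]
    simp [invRev]
  rcases Nat.even_or_odd' (norm u) with ⟨m, hm | hm⟩
  · have h := key m (by lia) (by lia)
    have e : u.toWord.length - 1 - m = m - 1 := by lia
    simp only [e] at h
    have hr : IsReduced u.toWord := isReduced_toWord
    have := List.isChain_iff_getElem.1 hr (m - 1) (by lia)
    simp only [show m - 1 + 1 = m by lia] at this
    simp [h] at this
  · have h := key m (by lia) (by lia)
    have e : u.toWord.length - 1 - m = m := by lia
    simp only [e] at h
    have := congrArg Prod.snd h
    simp at this

/-- A conjugate of a generator has a representation as a reduced conjugate. -/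
theorem exists_reduced_conj (i : α) (p : FreeGroup α) :
    ∃ q, p * of i * p⁻¹ = q * of i * q⁻¹ ∧ norm (q * of i * q⁻¹) = 2 * norm q + 1 := by
  induction hn : norm p using Nat.strong_induction_on generalizing p with
  | _ n ih =>
    subst hn
    by_cases hred : IsReduced (p.toWord ++ [(i, true)] ++ invRev p.toWord)
    · refine ⟨p, rfl, ?_⟩
      have : p * of i * p⁻¹ = mk (p.toWord ++ [(i, true)] ++ invRev p.toWord) := by
        rw [← mul_mk, ← mul_mk, ← inv_mk, mk_toWord, of]
      rw [this, norm_mk_of_isReduced hred]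
      simp [norm]; lia
    · rcases List.eq_nil_or_concat p.toWord with h | ⟨l, ⟨x, ε⟩, h⟩
      · simp [h] at hred
      · have hp : p = mk l * mk [(x, ε)] := by
          rw [mul_mk, ← List.concat_eq_append, ← h, mk_toWord]
        have hnorm : norm p = l.length + 1 := by simp [norm, h]
        have hx : x = i := by
          by_contra hx
          apply hred
          have hpw : IsReduced p.toWord := isReduced_toWord
          have hpi : IsReduced (invRev p.toWord) := by
            rw [← toWord_inv]; exact isReduced_toWord
          have hx' : ¬ i = x := fun e => hx e.symm
          simp only [List.append_assoc]
          refine List.isChain_append.2 ⟨hpw,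
            List.isChain_append.2 ⟨List.isChain_singleton _, hpi, ?_⟩, ?_⟩
          · simp [h, invRev, hx']
          · simp [h, hx]
        subst hx
        obtain ⟨q, hq, hq'⟩ := ih (norm (mk l))
          (by rw [hnorm]; exact Nat.lt_succ_of_le norm_mk_le) (mk l) rfl
        refine ⟨q, ?_, hq'⟩
        rw [← hq, hp]
        cases ε
        · have : mk [(x, false)] = (of x)⁻¹ := by simp [of, inv_mk, invRev]
          rw [this]; group
        · change mk l * of x * of x * (mk l * of x)⁻¹ = _
          group

end Gromov

section Weight

variable {α : Type*} [Fintype α]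

/-- The big-endian value of a word, read as a numeral in base `2 * |α| + 2`. -/
noncomputable def wordRank (l : List (α × Bool)) : ℕ :=
  Nat.ofDigits (Fintype.card (α × Bool) + 2)
    (l.reverse.map fun x => (Fintype.equivFin (α × Bool) x : ℕ))

theorem wordRank_append_lt {p q : List (α × Bool)} (h : wordRank p < wordRank q)
    (x : List (α × Bool)) : wordRank (p ++ x) < wordRank (q ++ x) := by
  simp only [wordRank, List.reverse_append, List.map_append, Nat.ofDigits_append] at h ⊢
  gcongr

theorem eq_of_wordRank_eq {p q : List (α × Bool)} (hl : p.length = q.length)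
    (h : wordRank p = wordRank q) : p = q := by
  have := Nat.ofDigits_inj_of_len_eq (b := Fintype.card (α × Bool) + 2) (by omega)
    (L1 := p.reverse.map fun x => (Fintype.equivFin (α × Bool) x : ℕ))
    (L2 := q.reverse.map fun x => (Fintype.equivFin (α × Bool) x : ℕ)) (by simpa using hl)
    (by
      intro d hd
      obtain ⟨x, -, rfl⟩ := List.mem_map.1 hd
      exact (Fin.is_lt _).trans (by omega))
    (by
      intro d hd
      obtain ⟨x, -, rfl⟩ := List.mem_map.1 hd
      exact (Fin.is_lt _).trans (by omega)) h
  have hinj : Function.Injective fun x : α × Bool => (Fintype.equivFin (α × Bool) x : ℕ) :=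
    Fin.val_injective.comp (Fintype.equivFin (α × Bool)).injective
  exact List.reverse_injective (List.map_injective_iff.2 hinj this)

variable [DecidableEq α]

/-- The initial half of the reduced word of `w`. -/
def half (w : FreeGroup α) : List (α × Bool) := w.toWord.take (norm w / 2)

/-- Length, refined by the position of the two halves in the lexicographic order. -/
noncomputable def weight (w : FreeGroup α) : ℕ ×ₗ ℕ :=
  toLex (norm w, wordRank (half w) + wordRank (half w⁻¹))

@[simp] theorem weight_inv (w : FreeGroup α) : weight w⁻¹ = weight w := by
  simp [weight, add_comm]

theorem weight_lt_of_norm_lt {v w : FreeGroup α} (h : norm v < norm w) : weight v < weight w :=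
  Prod.Lex.toLex_lt_toLex.2 (Or.inl h)

/-- Replacing an initial segment, of at most half the length, of one half of a word by a smaller
one lowers the weight. -/
theorem weight_mul_lt {P Q R : List (α × Bool)} {w : FreeGroup α} (hlen : P.length = Q.length)
    (hrank : wordRank P < wordRank Q) (hw : w.toWord = Q ++ R) (hQ : 2 * Q.length ≤ norm w) :
    weight (mk (P ++ R)) < weight w := by
  have hn : norm w = Q.length + R.length := by simp [norm, hw]
  have hle : norm (mk (P ++ R)) ≤ norm w := norm_mk_le.trans (by simp [hn, hlen])
  rcases hle.lt_or_eq with h | h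
  · exact weight_lt_of_norm_lt h
  have hword : (mk (P ++ R)).toWord = P ++ R := toWord_mk_of_norm_eq (by simp [h, hn, hlen])
  refine Prod.Lex.toLex_lt_toLex.2 (Or.inr ⟨h, ?_⟩)
  have e1 : half (mk (P ++ R)) = P ++ R.take (norm w / 2 - Q.length) := by
    rw [half, hword, h, List.take_append, hlen, List.take_of_length_le (by omega)]
  have e2 : half w = Q ++ R.take (norm w / 2 - Q.length) := by
    rw [half, hw, List.take_append, List.take_of_length_le (by omega)]
  have e3 : half (mk (P ++ R))⁻¹ = half w⁻¹ := by
    rw [half, half, norm_inv_eq, norm_inv_eq, toWord_inv, toWord_inv, hword, hw, h, invRev_append,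
      invRev_append, List.take_append_of_le_length (by simp; omega),
      List.take_append_of_le_length (by simp; omega)]
  simp only [e1, e2, e3]
  exact Nat.add_lt_add_right (wordRank_append_lt hrank _) _

theorem weight_conj_lt {P Q R : List (α × Bool)} {q : FreeGroup α} {i : α}
    (hlen : P.length = Q.length) (hrank : wordRank P < wordRank Q) (hq : q.toWord = Q ++ R)
    (hnorm : norm (q * of i * q⁻¹) = 2 * norm q + 1) :
    weight (mk (P ++ R) * of i * (mk (P ++ R))⁻¹) < weight (q * of i * q⁻¹) := by
  have hn : norm q = Q.length + R.length := by simp [norm, hq]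
  have eq_mk (L : List (α × Bool)) :
      mk L * of i * (mk L)⁻¹ = mk (L ++ (i, true) :: invRev L) := by
    rw [of, inv_mk, mul_mk, mul_mk, List.append_assoc, List.singleton_append]
  have hq' : q = mk (Q ++ R) := by rw [← hq, mk_toWord]
  have wordq : (q * of i * q⁻¹).toWord = (Q ++ R) ++ (i, true) :: invRev (Q ++ R) := by
    rw [hq', eq_mk]
    apply toWord_mk_of_norm_eq
    rw [← eq_mk, ← hq', hnorm, hn]
    simp; omega
  have hle : norm (mk (P ++ R) * of i * (mk (P ++ R))⁻¹) ≤ norm (q * of i * q⁻¹) := by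
    rw [eq_mk, hnorm, hn]
    exact norm_mk_le.trans (by simp [hlen]; omega)
  rcases hle.lt_or_eq with h | h
  · exact weight_lt_of_norm_lt h
  have wordp : (mk (P ++ R) * of i * (mk (P ++ R))⁻¹).toWord =
      (P ++ R) ++ (i, true) :: invRev (P ++ R) := by
    rw [eq_mk]
    apply toWord_mk_of_norm_eq
    rw [← eq_mk, h, hnorm, hn]
    simp [hlen]; omega
  refine Prod.Lex.toLex_lt_toLex.2 (Or.inr ⟨h, ?_⟩)
  have hhalf : (2 * norm q + 1) / 2 = Q.length + R.length := by omega
  have key {L : List (α × Bool)} {w : FreeGroup α} (hw : w.toWord = L ++ (i, true) :: invRev L)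
      (hwn : norm w / 2 = L.length) : half w = L ∧ half w⁻¹ = L := by
    constructor
    · rw [half, hw, hwn, List.take_left']
      rfl
    · rw [half, norm_inv_eq, toWord_inv, hw, hwn, invRev_append, invRev_cons, invRev_invRev,
        List.append_assoc, List.take_left']
      rfl
  obtain ⟨h1, h2⟩ := key wordp (by rw [h, hnorm, hhalf]; simp [hlen])
  obtain ⟨h3, h4⟩ := key wordq (by rw [hnorm, hhalf]; simp)
  simp only [h1, h2, h3, h4]
  have := wordRank_append_lt hrank R
  omega

end Weight

section Nielsen

variable {α : Type*}

/-- The value of a letter under a substitution of the generators. -/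
def letterVal (U : α → FreeGroup α) (x : α × Bool) : FreeGroup α := cond x.2 (U x.1) (U x.1)⁻¹

theorem letterVal_not (U : α → FreeGroup α) (x : α × Bool) :
    letterVal U (x.1, !x.2) = (letterVal U x)⁻¹ := by
  obtain ⟨i, ε⟩ := x
  cases ε <;> simp [letterVal]

variable [DecidableEq α]

theorem norm_letterVal (U : α → FreeGroup α) (x : α × Bool) :
    norm (letterVal U x) = norm (U x.1) := by
  obtain ⟨i, ε⟩ := x
  cases ε <;> simp [letterVal]

/-- If consecutive letters of reduced words cancel so little that something of each letter
survives, then the length of an element bounds its length in the letters. -/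
theorem length_le_norm_prod {U : α → FreeGroup α}
    (hhalf : ∀ x y : α × Bool, (x.1 = y.1 → x.2 = y.2) →
      2 * gromov (letterVal U x)⁻¹ (letterVal U y) ≤ norm (letterVal U x))
    (hmid : ∀ x y z : α × Bool, (x.1 = y.1 → x.2 = y.2) → (y.1 = z.1 → y.2 = z.2) →
      gromov (letterVal U x)⁻¹ (letterVal U y) + gromov (letterVal U y)⁻¹ (letterVal U z) <
        norm (letterVal U y))
    (hpos : ∀ i, U i ≠ 1) {L : List (α × Bool)} (hL : IsReduced L) :
    L.length ≤ norm ((L.map (letterVal U)).prod) := by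
  have hpos' (x : α × Bool) : 0 < norm (letterVal U x) := by
    rw [norm_letterVal, Nat.pos_iff_ne_zero, ne_eq, norm_eq_zero]; exact hpos _
  have key (x : α × Bool) (L : List (α × Bool)) (hL : IsReduced (x :: L)) :
      L.length + 1 ≤ norm (((x :: L).map (letterVal U)).prod) ∧
      ∀ y, (y.1 = x.1 → y.2 = x.2) →
        gromov (letterVal U y)⁻¹ ((x :: L).map (letterVal U)).prod =
          gromov (letterVal U y)⁻¹ (letterVal U x) ∧
        L.length + 1 + gromov (letterVal U y)⁻¹ (letterVal U x) ≤
          norm (((x :: L).map (letterVal U)).prod) := by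
    induction L generalizing x with
    | nil =>
      have := hpos' x
      simp only [List.map_cons, List.map_nil, List.prod_cons, List.prod_nil, mul_one,
        List.length_nil, zero_add, true_and]
      refine ⟨this, fun y hy => ?_⟩
      have h := hhalf (x.1, !x.2) (y.1, !y.2) (by simpa [eq_comm] using hy)
      rw [letterVal_not, letterVal_not, norm_inv_eq, inv_inv, gromov_comm] at h
      omega
    | cons z L ih =>
      obtain ⟨hxz, hzL⟩ := isReduced_cons_cons.1 hL
      obtain ⟨h1, h2⟩ := ih z hzL
      obtain ⟨h3, h4⟩ := h2 x hxz
      set w := ((z :: L).map (letterVal U)).prod with hw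
      have hprod : ((x :: z :: L).map (letterVal U)).prod = letterVal U x * w := by
        rw [hw, List.map_cons, List.prod_cons]
      rw [hprod]
      have hn := norm_mul (letterVal U x) w
      rw [h3] at hn
      have hh := hhalf x z hxz
      have hp := hpos' x
      refine ⟨by simp only [List.length_cons]; omega, fun y hy => ?_⟩
      have hm := hmid y x z hy hxz
      have hg := norm_inv_mul (letterVal U x) (letterVal U x * w)
      rw [inv_mul_cancel_left] at hg
      have hlt : gromov (letterVal U y)⁻¹ (letterVal U x) <
          gromov (letterVal U x) (letterVal U x * w) := by omega
      refine ⟨?_, by simp only [List.length_cons]; omega⟩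
      have m1 := min_gromov_le (letterVal U y)⁻¹ (letterVal U x) (letterVal U x * w)
      have m2 := min_gromov_le (letterVal U y)⁻¹ (letterVal U x * w) (letterVal U x)
      rw [gromov_comm (letterVal U x * w)] at m2
      omega
  cases L with
  | nil => simp
  | cons x L => exact (key x L hL).1

/-- A basis satisfying the conditions of `length_le_norm_prod` consists of elements of length
one. -/
theorem norm_eq_one_of_bijective [Finite α] {U : α → FreeGroup α}
    (hU : Function.Bijective (lift U))
    (hhalf : ∀ x y : α × Bool, (x.1 = y.1 → x.2 = y.2) →
      2 * gromov (letterVal U x)⁻¹ (letterVal U y) ≤ norm (letterVal U x))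
    (hmid : ∀ x y z : α × Bool, (x.1 = y.1 → x.2 = y.2) → (y.1 = z.1 → y.2 = z.2) →
      gromov (letterVal U x)⁻¹ (letterVal U y) + gromov (letterVal U y)⁻¹ (letterVal U z) <
        norm (letterVal U y)) (i : α) : norm (U i) = 1 := by
  have hpos (i : α) : U i ≠ 1 := fun h =>
    of_ne_one i (hU.1 (by simpa using h))
  have key (j : α) : ∃ x : α × Bool, letterVal U x = of j := by
    obtain ⟨w, hw⟩ := hU.2 (of j)
    have hw' : (w.toWord.map (letterVal U)).prod = of j := by
      rw [← hw]
      conv_rhs => rw [← mk_toWord (x := w), lift_mk]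
      rfl
    have hlen := length_le_norm_prod hhalf hmid hpos (isReduced_toWord (x := w))
    rw [hw', norm_of] at hlen
    match h : w.toWord, hlen with
    | [], _ => exact absurd (by rw [← hw, toWord_eq_nil_iff.1 h, _root_.map_one]) (of_ne_one j)
    | [x], _ => exact ⟨x, by simpa [h] using hw'⟩
  choose f hf using key
  have hinj : Function.Injective fun j => (f j).1 := by
    intro j k hjk
    simp only at hjk
    by_cases h : (f j).2 = (f k).2
    · exact of_injective (by rw [← hf j, ← hf k, show f j = f k from Prod.ext hjk h])
    · have : f j = ((f k).1, !(f k).2) := Prod.ext hjk (Bool.eq_not.2 h)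
      have e : (of j : FreeGroup α) = (of k)⁻¹ := by rw [← hf j, ← hf k, this, letterVal_not]
      have := congrArg toWord e
      simp [toWord_inv, invRev] at this
  obtain ⟨j, hj⟩ := Finite.surjective_of_injective hinj i
  simp only at hj
  rw [← hj, ← norm_letterVal, hf, norm_of]

end Nielsen

section Minimal

variable {α : Type*} [DecidableEq α]

/-- The reduced word of a conjugate of a generator, or of the inverse of one. -/
theorem toWord_letterVal_of_conj {U : α → FreeGroup α} {y : α × Bool} {q : FreeGroup α}
    (hq : U y.1 = q * of y.1 * q⁻¹) (hn : norm (U y.1) = 2 * norm q + 1) :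
    (letterVal U y).toWord = q.toWord ++ y :: invRev q.toWord := by
  have e : letterVal U y = mk (q.toWord ++ y :: invRev q.toWord) := by
    have h : mk (q.toWord ++ y :: invRev q.toWord) = q * mk [y] * q⁻¹ := by
      conv_rhs => rw [← mk_toWord (x := q)]
      rw [inv_mk, mul_mk, mul_mk, List.append_assoc, List.singleton_append]
    rw [h]
    obtain ⟨i, ε⟩ := y
    cases ε
    · have : mk [(i, false)] = (of i)⁻¹ := by simp [of, inv_mk, invRev]
      simp only [letterVal, cond_false, hq, this]
      group
    · exact hq
  rw [e]
  apply toWord_mk_of_norm_eq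
  rw [← e, norm_letterVal, hn]
  simp [norm]; omega

/-- An element of even length taking the second half of its inverse to its first half. -/
theorem mul_mk_take_inv {v : FreeGroup α} {h : ℕ} (hv : norm v = 2 * h) :
    v * mk (v⁻¹.toWord.take h) = mk (v.toWord.take h) := by
  have hlen : v.toWord.length = 2 * h := hv
  have hd : v.toWord.drop h = invRev (v⁻¹.toWord.take h) := by
    rw [toWord_inv]
    simp [invRev, List.take_reverse, hlen]
    rw [show 2 * h - h = h by omega]
    simp [Function.comp_def]
  have : v = mk (v.toWord.take h) * mk (invRev (v⁻¹.toWord.take h)) := by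
    rw [mul_mk, ← hd, List.take_append_drop, mk_toWord]
  nth_rewrite 1 [this]
  rw [← inv_mk, inv_mul_cancel_right]

variable [Fintype α]

/-- A tuple whose entries indexed by `κ` are conjugates of the corresponding generators, and whose
weight cannot be lowered by multiplying an entry outside `κ`, or conjugating an entry in `κ`, by
another entry. -/
structure IsNielsenMinimal (κ : Set α) (U : α → FreeGroup α) : Prop where
  ne_one : ∀ i, U i ≠ 1
  conj : ∀ i ∈ κ, ∃ p, U i = p * of i * p⁻¹
  mul : ∀ x y : α × Bool, x.1 ≠ y.1 → y.1 ∉ κ →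
    ¬ weight (letterVal U x * letterVal U y) < weight (letterVal U y)
  conj_mul : ∀ (x : α × Bool) (i : α), x.1 ≠ i → i ∈ κ →
    ¬ weight (letterVal U x * U i * (letterVal U x)⁻¹) < weight (U i)

namespace IsNielsenMinimal

variable {κ : Set α} {U : α → FreeGroup α} (hU : IsNielsenMinimal κ U)
include hU

theorem exists_reduced_conj {i : α} (hi : i ∈ κ) :
    ∃ q, U i = q * of i * q⁻¹ ∧ norm (U i) = 2 * norm q + 1 := by
  obtain ⟨p, hp⟩ := hU.conj i hi
  obtain ⟨q, hq, hq'⟩ := FreeGroup.exists_reduced_conj i p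
  exact ⟨q, hp.trans hq, by rw [hp, hq, hq']⟩

theorem two_mul_gromov_le_of_notMem {x y : α × Bool} (hxy : x.1 ≠ y.1) (hy : y.1 ∉ κ) :
    2 * gromov (letterVal U x)⁻¹ (letterVal U y) ≤ norm (letterVal U x) := by
  have h1 := norm_mul (letterVal U x) (letterVal U y)
  have h2 : ¬ norm (letterVal U x * letterVal U y) < norm (letterVal U y) :=
    fun h => hU.mul x y hxy hy (weight_lt_of_norm_lt h)
  omega

theorem two_mul_min_gromov_le {x y : α × Bool} {q : FreeGroup α} (hxy : x.1 ≠ y.1) (hy : y.1 ∈ κ)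
    (hq : U y.1 = q * of y.1 * q⁻¹) (hn : norm (U y.1) = 2 * norm q + 1) :
    2 * min (gromov (letterVal U x)⁻¹ (letterVal U y)) (norm q) ≤ norm (letterVal U x) := by
  by_contra! h
  have hword := toWord_letterVal_of_conj hq hn
  have hle : min (gromov (letterVal U x)⁻¹ (letterVal U y)) (norm q) ≤
      gromov (letterVal U x)⁻¹ q := by
    have h1 := le_gromov_iff.1 (min_le_left (gromov (letterVal U x)⁻¹ (letterVal U y)) (norm q))
    refine le_gromov_iff.2 ⟨h1.1, min_le_right _ _, h1.2.2.trans ?_⟩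
    rw [hword]
    exact List.take_append_of_le_length (min_le_right _ (norm q))
  have h1 := norm_mul (letterVal U x) q
  have h2 : norm (letterVal U x * q) < norm q := by omega
  refine hU.conj_mul x y.1 hxy hy (weight_lt_of_norm_lt ?_)
  have e : letterVal U x * U y.1 * (letterVal U x)⁻¹ =
      (letterVal U x * q) * of y.1 * (letterVal U x * q)⁻¹ := by
    rw [hq]; group
  rw [e, hn]
  have h3 := norm_mul_le (letterVal U x * q * of y.1) (letterVal U x * q)⁻¹
  have h4 := norm_mul_le (letterVal U x * q) (of y.1)
  rw [norm_inv_eq] at h3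
  rw [norm_of] at h4
  omega

theorem two_mul_gromov_le (x y : α × Bool) (hxy : x.1 = y.1 → x.2 = y.2) :
    2 * gromov (letterVal U x)⁻¹ (letterVal U y) ≤ norm (letterVal U x) := by
  by_cases h : x.1 = y.1
  · rw [Prod.ext h (hxy h)]
    exact two_mul_gromov_inv_self_le _
  by_cases hy : y.1 ∈ κ
  swap
  · exact hU.two_mul_gromov_le_of_notMem h hy
  obtain ⟨q, hq, hqn⟩ := hU.exists_reduced_conj hy
  have h1 := hU.two_mul_min_gromov_le h hy hq hqn
  have hny := norm_letterVal U y
  by_cases hx : x.1 ∈ κ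
  swap
  · have h2 := hU.two_mul_gromov_le_of_notMem (x := (y.1, !y.2)) (y := (x.1, !x.2)) (Ne.symm h) hx
    rw [letterVal_not, letterVal_not, inv_inv, norm_inv_eq, gromov_comm] at h2
    omega
  obtain ⟨p, hp, hpn⟩ := hU.exists_reduced_conj hx
  have h2 := hU.two_mul_min_gromov_le (x := (y.1, !y.2)) (y := (x.1, !x.2)) (Ne.symm h) hx hp hpn
  rw [letterVal_not, letterVal_not, inv_inv, norm_inv_eq, gromov_comm] at h2
  have hnx := norm_letterVal U x
  by_contra! hlt
  have hpq : norm p = norm q := by omega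
  have hk : norm q + 1 ≤ gromov (letterVal U x)⁻¹ (letterVal U y) := by omega
  have ht := (le_gromov_iff.1 hk).2.2
  rw [← letterVal_not, toWord_letterVal_of_conj hq hqn,
    toWord_letterVal_of_conj (y := (x.1, !x.2)) hp hpn] at ht
  have hl := congrArg (fun l => l[norm q]?) ht
  have hpq' : p.toWord.length = q.toWord.length := hpq
  have hqq : norm q = q.toWord.length := rfl
  simp [hqq, ← hpq'] at hl
  exact h (by rw [← hl])

theorem not_wordRank_lt (y z : α × Bool) (hyz : y.1 = z.1 → y.2 = z.2) {h : ℕ}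
    (hy : norm (letterVal U y) = 2 * h)
    (hg : gromov (letterVal U y)⁻¹ (letterVal U z) = h) :
    ¬ wordRank ((letterVal U y).toWord.take h) < wordRank ((letterVal U y)⁻¹.toWord.take h) := by
  intro hlt
  obtain ⟨-, hz, ht⟩ := le_gromov_iff.1 hg.ge
  have hne : y.1 ≠ z.1 := by
    intro e
    have : y = z := Prod.ext e (hyz e)
    rw [ht, this] at hlt
    exact lt_irrefl _ hlt
  set v := letterVal U y with hv
  set P := v.toWord.take h with hP
  set Q := v⁻¹.toWord.take h with hQ
  have hPl : P.length = h := by rw [hP, List.length_take, ← norm, hy]; omega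
  have hQl : Q.length = h := by rw [hQ, List.length_take, ← norm, norm_inv_eq, hy]; omega
  have hvPQ : v * FreeGroup.mk Q = FreeGroup.mk P := mul_mk_take_inv hy
  have hzhalf : 2 * h ≤ norm (letterVal U z) := by
    have := hU.two_mul_gromov_le (z.1, !z.2) (y.1, !y.2) (by simpa [eq_comm] using hyz)
    rw [letterVal_not, letterVal_not, inv_inv, norm_inv_eq, gromov_comm, ← hv, hg] at this
    exact this
  by_cases hzκ : z.1 ∈ κ
  · obtain ⟨q, hq, hqn⟩ := hU.exists_reduced_conj hzκ
    have hqh : h ≤ norm q := by rw [norm_letterVal, hqn] at hzhalf; omega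
    have hqw : q.toWord = Q ++ q.toWord.drop h := by
      rw [ht, toWord_letterVal_of_conj hq hqn, List.take_append_of_le_length hqh,
        List.take_append_drop]
    refine hU.conj_mul y z.1 hne hzκ ?_
    have := weight_conj_lt (i := z.1) (hPl.trans hQl.symm) hlt hqw (by rw [← hq, hqn])
    convert this using 2
    have e : FreeGroup.mk (P ++ q.toWord.drop h) = v * q := by
      conv_rhs => rw [← mk_toWord (x := q), hqw]
      rw [← mul_mk, ← mul_mk, ← hvPQ, mul_assoc]
    rw [e, hq, ← hv]
    group
  · have hzw : (letterVal U z).toWord = Q ++ (letterVal U z).toWord.drop h := by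
      rw [ht, List.take_append_drop]
    refine hU.mul y z hne hzκ ?_
    have := weight_mul_lt (hPl.trans hQl.symm) hlt hzw (by rw [hQl]; exact hzhalf)
    convert this using 2
    conv_lhs => rw [← mk_toWord (x := letterVal U z), hzw]
    rw [← mul_mk, ← mul_mk, ← hvPQ, mul_assoc]

theorem gromov_add_gromov_lt (x y z : α × Bool) (hxy : x.1 = y.1 → x.2 = y.2)
    (hyz : y.1 = z.1 → y.2 = z.2) :
    gromov (letterVal U x)⁻¹ (letterVal U y) + gromov (letterVal U y)⁻¹ (letterVal U z) <
      norm (letterVal U y) := by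
  have h1 := hU.two_mul_gromov_le y z hyz
  have h2 := hU.two_mul_gromov_le (y.1, !y.2) (x.1, !x.2) (by simpa [eq_comm] using hxy)
  have h3 := hU.not_wordRank_lt y z hyz (h := gromov (letterVal U y)⁻¹ (letterVal U z))
  have h4 := hU.not_wordRank_lt (y.1, !y.2) (x.1, !x.2) (by simpa [eq_comm] using hxy)
    (h := gromov (letterVal U y)⁻¹ (letterVal U z))
  rw [letterVal_not, letterVal_not, inv_inv, norm_inv_eq, gromov_comm] at h2
  rw [letterVal_not, letterVal_not, inv_inv, norm_inv_eq, gromov_comm (letterVal U y)] at h4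
  by_contra! hlt
  have hn : norm (letterVal U y) = 2 * gromov (letterVal U y)⁻¹ (letterVal U z) := by omega
  have hr := le_antisymm (not_lt.1 (h4 hn (by omega))) (not_lt.1 (h3 hn rfl))
  set h := gromov (letterVal U y)⁻¹ (letterVal U z) with hh
  have hlen1 : (letterVal U y).toWord.length = 2 * h := hn
  have e := eq_of_wordRank_eq (by simp [hlen1]) hr
  have hm := mul_mk_take_inv hn
  rw [e, mul_eq_right] at hm
  refine hU.ne_one y.1 ?_
  rw [← norm_eq_zero, ← norm_letterVal U y, hm, norm_one]

end IsNielsenMinimal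

end Minimal

section Induction

variable {α : Type*}

theorem lift_letterVal_of (U : α → FreeGroup α) (x : α × Bool) :
    lift U (letterVal of x) = letterVal U x := by
  obtain ⟨i, ε⟩ := x
  cases ε <;> simp [letterVal]

variable [DecidableEq α]

theorem lift_update_letterVal {U : α → FreeGroup α} {x : α × Bool} {i : α} (hx : x.1 ≠ i)
    (w : FreeGroup α) : letterVal (Function.update U i w) x = letterVal U x := by
  simp [letterVal, hx]

/-- Multiplying an entry of a basis on both sides by words in the other entries gives a basis. -/
theorem bijective_lift_update {U : α → FreeGroup α} (hU : Function.Bijective (lift U)) {i : α}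
    {g h : FreeGroup α} (hg : ∀ w, lift (Function.update of i w) g = g)
    (hh : ∀ w, lift (Function.update of i w) h = h) :
    Function.Bijective (lift (Function.update U i (lift U g * U i * lift U h))) := by
  have e1 : lift (Function.update U i (lift U g * U i * lift U h)) =
      (lift U).comp (lift (Function.update of i (g * of i * h))) := by
    ext j
    by_cases hj : j = i
    · subst hj; simp
    · simp [hj]
  have key (g h : FreeGroup α) (hg : ∀ w, lift (Function.update of i w) g = g)
      (hh : ∀ w, lift (Function.update of i w) h = h) (x : FreeGroup α) :
      lift (Function.update of i (g * of i * h))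
        (lift (Function.update of i (g⁻¹ * of i * h⁻¹)) x) = x := by
    rw [← MonoidHom.comp_apply]
    refine DFunLike.congr_fun (?_ : _ = MonoidHom.id _) x
    ext j
    by_cases hj : j = i
    · subst hj
      simp [hg, hh, mul_assoc]
    · simp [hj]
  rw [e1, MonoidHom.coe_comp]
  refine hU.comp (Function.bijective_iff_has_inverse.2
    ⟨lift (Function.update of i (g⁻¹ * of i * h⁻¹)), ?_, key g h hg hh⟩)
  intro x
  simpa using key g⁻¹ h⁻¹ (by simpa using hg) (by simpa using hh) x

/-- Nielsen reduction, as an induction principle for bases whose entries indexed by `κ` are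
conjugates of the corresponding generators. -/
theorem nielsen_induction [Fintype α] {κ : Set α} {S : (α → FreeGroup α) → Prop}
    (base : ∀ U, Function.Bijective (lift U) → (∀ i ∈ κ, ∃ p, U i = p * of i * p⁻¹) →
      (∀ i, norm (U i) = 1) → S U)
    (mul_left : ∀ U (x : α × Bool) (i : α), x.1 ≠ i → i ∉ κ →
      S (Function.update U i (letterVal U x * U i)) → S U)
    (mul_right : ∀ U (x : α × Bool) (i : α), x.1 ≠ i → i ∉ κ →
      S (Function.update U i (U i * letterVal U x)) → S U)
    (conj : ∀ U (x : α × Bool) (i : α), x.1 ≠ i → i ∈ κ →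
      S (Function.update U i (letterVal U x * U i * (letterVal U x)⁻¹)) → S U)
    (U : α → FreeGroup α) (hU : Function.Bijective (lift U))
    (hκ : ∀ i ∈ κ, ∃ p, U i = p * of i * p⁻¹) : S U := by
  induction hW : ∑ i, weight (U i) using WellFoundedLT.induction generalizing U with
  | _ W ih =>
  subst hW
  have step {i : α} {u : FreeGroup α} (h : weight u < weight (U i)) :
      ∑ j, weight (Function.update U i u j) < ∑ j, weight (U j) := by
    refine Finset.sum_lt_sum (fun j _ => ?_) ⟨i, Finset.mem_univ _, by simpa using h⟩
    by_cases hj : j = i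
    · subst hj; simpa using h.le
    · simp [hj]
  have hfix {x : α × Bool} {i : α} (hx : x.1 ≠ i) (w : FreeGroup α) :
      lift (Function.update of i w) (letterVal of x) = letterVal of x := by
    rw [lift_letterVal_of, lift_update_letterVal hx]
  have hne {i : α} {u : FreeGroup α} (hi : i ∉ κ) :
      ∀ j ∈ κ, ∃ p, Function.update U i u j = p * of j * p⁻¹ := by
    intro j hj
    rw [Function.update_of_ne (ne_of_mem_of_not_mem hj hi)]
    exact hκ j hj
  have hone (i : α) : U i ≠ 1 := fun h => of_ne_one i (hU.1 (by simpa using h))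
  by_cases hmin : IsNielsenMinimal κ U
  · exact base U hU hκ
      (norm_eq_one_of_bijective hU hmin.two_mul_gromov_le hmin.gromov_add_gromov_lt)
  by_cases hm : ∃ x y : α × Bool, x.1 ≠ y.1 ∧ y.1 ∉ κ ∧
      weight (letterVal U x * letterVal U y) < weight (letterVal U y)
  · obtain ⟨x, ⟨i, ε⟩, hx, hi, hlt⟩ := hm
    cases ε
    · have hx' : (x.1, !x.2).1 ≠ i := hx
      refine mul_right U (x.1, !x.2) i hx hi (ih _ (step ?_) _ ?_ (hne hi) rfl)
      · rw [← weight_inv, ← weight_inv (U i), mul_inv_rev, letterVal_not, inv_inv]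
        exact hlt
      · have := bijective_lift_update hU (i := i) (g := 1) (by simp) (hfix hx')
        rwa [_root_.map_one, one_mul, lift_letterVal_of] at this
    · refine mul_left U x i hx hi (ih _ (step hlt) _ ?_ (hne hi) rfl)
      have := bijective_lift_update hU (i := i) (h := 1) (hfix hx) (by simp)
      rwa [_root_.map_one, mul_one, lift_letterVal_of] at this
  · by_cases hc : ∃ (x : α × Bool) (i : α), x.1 ≠ i ∧ i ∈ κ ∧
        weight (letterVal U x * U i * (letterVal U x)⁻¹) < weight (U i)
    · obtain ⟨x, i, hx, hi, hlt⟩ := hc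
      refine conj U x i hx hi (ih _ (step hlt) _ ?_ ?_ rfl)
      · have := bijective_lift_update hU (i := i) (hfix hx)
          (h := (letterVal of x)⁻¹) (fun w => by rw [_root_.map_inv, hfix hx])
        rwa [_root_.map_inv, lift_letterVal_of] at this
      · intro j hj
        by_cases hji : j = i
        · subst hji
          obtain ⟨p, hp⟩ := hκ j hj
          exact ⟨letterVal U x * p, by rw [Function.update_self, hp]; group⟩
        · rw [Function.update_of_ne hji]
          exact hκ j hj
    · push Not at hm hc
      exact absurd ⟨hone, hκ, fun x y h1 h2 => not_lt.2 (hm x y h1 h2),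
        fun x i h1 h2 => not_lt.2 (hc x i h1 h2)⟩ hmin

end Induction

end FreeGroup

namespace HNNExtension

open NormalWord

variable {G : Type*} [Group G] {A B : Subgroup G} {φ : A ≃* B}

theorem exists_reducedWord_prod_eq (x : HNNExtension G A B φ) :
    ∃ w : ReducedWord G A B, w.prod φ = x := by
  obtain ⟨d⟩ := TransversalPair.nonempty G A B
  exact ⟨(equiv φ d x).toReducedWord, (equiv φ d).symm_apply_apply x⟩

/-- Multiplying a nonempty reduced word by an element of the base group on the right. -/
theorem exists_toList_mul_of (β : G) (L : List (ℤˣ × G)) (hL : L ≠ [])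
    (hc : L.IsChain (fun a b => a.2 ∈ toSubgroup A B a.1 → a.1 = b.1)) :
    ∃ L' : List (ℤˣ × G), L'.IsChain (fun a b => a.2 ∈ toSubgroup A B a.1 → a.1 = b.1) ∧
      L'.map Prod.fst = L.map Prod.fst ∧
      (L'.map fun x => (t ^ (x.1 : ℤ) * of x.2 : HNNExtension G A B φ)).prod =
        (L.map fun x => t ^ (x.1 : ℤ) * of x.2).prod * of β := by
  induction L with
  | nil => exact absurd rfl hL
  | cons a l ih =>
    cases l with
    | nil => exact ⟨[(a.1, a.2 * β)], by simp, by simp, by simp [mul_assoc]⟩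
    | cons b l =>
      obtain ⟨L', h1, h2, h3⟩ := ih (by simp) (List.isChain_cons_cons.1 hc).2
      refine ⟨a :: L', ?_, by simp [h2], by simp [h3, mul_assoc]⟩
      cases L' with
      | nil => simp at h2
      | cons b' L' =>
        simp only [List.map_cons, List.cons.injEq] at h2
        exact List.isChain_cons_cons.2 ⟨h2.1 ▸ (List.isChain_cons_cons.1 hc).1, h1⟩

/-- An endomorphism which twists the stable letter and moves `x` by an element of the base group
can only do so if `x` involves the stable letter at most once. -/
theorem exists_eq_of_map_eq_mul_of {τ : HNNExtension G A B φ →* HNNExtension G A B φ} {z : ℤˣ → G}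
    (hτ : ∀ g, τ (of g) = of g) (hτt : ∀ u : ℤˣ, τ (t ^ (u : ℤ)) = t ^ (u : ℤ) * of (z u))
    (hz : ∀ u, z u ∈ toSubgroup A B u)
    (hconj : ∀ u v g, g⁻¹ * z u * g ∈ toSubgroup A B v → v = u ∧ g ∈ toSubgroup A B u)
    {x : HNNExtension G A B φ} {β : G} (hx : τ x = x * of β) :
    (∃ g, x = of g) ∨ ∃ (g : G) (u : ℤˣ) (g' : G), x = of g * t ^ (u : ℤ) * of g' ∧
      z u = g' * β * g'⁻¹ := by
  obtain ⟨⟨g₀, L, hL⟩, rfl⟩ := exists_reducedWord_prod_eq x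
  simp only [ReducedWord.prod] at hx ⊢
  match L, hL with
  | [], _ => exact Or.inl ⟨g₀, by simp⟩
  | [(u, g)], _ =>
    refine Or.inr ⟨g₀, u, g, by simp [mul_assoc], ?_⟩
    simp only [List.map_cons, List.map_nil, List.prod_cons, List.prod_nil, mul_one, map_mul, hτ,
      hτt, mul_assoc, mul_right_inj] at hx
    rw [← map_mul, ← map_mul] at hx
    rw [eq_mul_inv_iff_mul_eq]
    exact of_injective φ hx
  | (u, g) :: b :: l, hL =>
    exfalso
    obtain ⟨h1, h2⟩ := List.isChain_cons_cons.1 hL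
    obtain ⟨L', h3, h4, h5⟩ := exists_toList_mul_of (φ := φ) β (b :: l) (by simp) h2
    have h6 : ((b :: l).map fun a => (a.1, z a.1 * a.2)).IsChain
        (fun a b => a.2 ∈ toSubgroup A B a.1 → a.1 = b.1) := by
      rw [List.isChain_map]
      refine h2.imp fun a b hab hmem => hab ?_
      exact ((toSubgroup A B a.1).mul_mem_cancel_left (hz a.1)).1 hmem
    have hmap (l : List (ℤˣ × G)) :
        τ (l.map fun x => t ^ (x.1 : ℤ) * of x.2).prod =
          ((l.map fun a => (a.1, z a.1 * a.2)).map fun x => t ^ (x.1 : ℤ) * of x.2).prod := by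
      rw [map_list_prod, List.map_map, List.map_map]
      congr 2
      ext a
      simp [hτ, hτt, mul_assoc]
    have hprod : ReducedWord.prod φ ⟨z u * g, _, h6⟩ = ReducedWord.prod φ ⟨g, L', h3⟩ := by
      simp only [ReducedWord.prod, h5, ← hmap]
      rw [List.map_cons, List.prod_cons, map_mul, map_mul, map_mul, hτ, hτ, hτt] at hx
      simp only [mul_assoc, mul_right_inj] at hx
      rw [map_mul, mul_assoc]
      exact hx
    have := (ReducedWord.map_fst_eq_and_of_prod_eq φ hprod).2 b.1 (by simp)
    have h7 : g⁻¹ * z u * g ∈ toSubgroup A B (-b.1) := by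
      rw [← inv_mem_iff]
      simpa [mul_assoc] using this
    obtain ⟨h8, h9⟩ := hconj _ _ _ h7
    have := h1 h9
    simp only [← this] at h8
    rcases Int.units_eq_one_or u with rfl | rfl <;> exact absurd h8 (by decide)

end HNNExtension

namespace FreeGroup

section ExpSum

variable {α : Type*} [DecidableEq α]

theorem mem_zpowers_of_commute {i : α} {g : FreeGroup α} (h : Commute g (of i)) :
    g ∈ Subgroup.zpowers (of i) := by
  induction hn : norm g using Nat.strong_induction_on generalizing g with
  | _ n ih =>
  subst hn
  have hi := Subgroup.mem_zpowers (of i)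
  have step {u : FreeGroup α} (hu : u ∈ Subgroup.zpowers (of i)) (hn : norm (u * g) < norm g) :
      g ∈ Subgroup.zpowers (of i) := by
    obtain ⟨k, rfl⟩ := hu
    rw [← Subgroup.mul_mem_cancel_left _ (Subgroup.zpow_mem _ hi k)]
    exact ih _ hn ((Commute.zpow_self (of i) k).mul_left h) rfl
  have h1 := norm_mul (of i) g
  have h2 := norm_mul (of i)⁻¹ g
  rw [norm_inv_eq, inv_inv] at h2
  rw [norm_of] at h1 h2
  by_cases h3 : norm (of i * g) < norm g
  · exact step hi h3
  by_cases h4 : norm ((of i)⁻¹ * g) < norm g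
  · exact step (inv_mem hi) h4
  have e1 : of i * g = mk ((i, true) :: g.toWord) := by
    conv_lhs => rw [← mk_toWord (x := g), of, mul_mk, List.singleton_append]
  have e2 : of i * g = mk (g.toWord ++ [(i, true)]) := by
    rw [← h.eq]
    conv_lhs => rw [← mk_toWord (x := g), of, mul_mk]
  have hl : norm g = g.toWord.length := rfl
  have w1 := toWord_mk_of_norm_eq (L := (i, true) :: g.toWord) (by
    rw [← e1, List.length_cons]; omega)
  have w2 := toWord_mk_of_norm_eq (L := g.toWord ++ [(i, true)]) (by
    rw [← e2, List.length_append, List.length_singleton]; omega)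
  rw [← e1, e2, w2] at w1
  cases hg : g.toWord with
  | nil => rw [toWord_eq_nil_iff.1 hg]; exact one_mem _
  | cons a l =>
    rw [hg, List.cons_append, List.cons.injEq] at w1
    have : 1 ≤ gromov (of i) g := le_gromov_iff.2 ⟨by simp, by simp [hl, hg], by simp [hg, w1.1]⟩
    omega

/-- The exponent sum of a generator. -/
def expSum (j : α) : FreeGroup α →* Multiplicative ℤ :=
  lift fun i => Multiplicative.ofAdd (if i = j then 1 else 0)

@[simp] theorem expSum_of (j i : α) :
    expSum j (of i) = Multiplicative.ofAdd (if i = j then (1 : ℤ) else 0) :=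
  lift_apply_of

/-- A conjugate of a power of a generator lies in the subgroup of a generator only trivially. -/
theorem eq_and_mem_zpowers_of_conj_mem {i j : α} {k : ℤ} (hk : k = 1 ∨ k = -1) {g : FreeGroup α}
    (h : g⁻¹ * of i ^ k * g ∈ Subgroup.zpowers (of j)) :
    i = j ∧ g ∈ Subgroup.zpowers (of i) := by
  obtain ⟨m, hm⟩ := h
  simp only at hm
  have h1 := congrArg (fun x => Multiplicative.toAdd (expSum i x)) hm
  simp only [_root_.map_zpow, _root_.map_mul, _root_.map_inv, expSum_of, toAdd_mul, toAdd_inv,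
    toAdd_zpow, toAdd_ofAdd, if_true, smul_eq_mul] at h1
  have hij : i = j := by
    by_contra hij
    rw [if_neg (Ne.symm hij)] at h1
    omega
  subst hij
  refine ⟨rfl, mem_zpowers_of_commute ?_⟩
  simp only [if_true] at h1
  have hmk : m = k := by omega
  subst hmk
  have hc : Commute g (of i ^ m) := by
    rw [mul_assoc, eq_inv_mul_iff_mul_eq] at hm
    exact hm
  rcases hk with rfl | rfl
  · simpa using hc
  · simpa using hc

end ExpSum

/-- The elements `b`, `aba⁻¹`, `c`, `d` of the free group on `a`, `b`, `c`, `d`. They freely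
generate the subgroup fixed by the Nielsen automorphism. -/
def fixedBasis : Fin 4 → FreeGroup (Fin 4) :=
  ![of 1, of 0 * of 1 * (of 0)⁻¹, of 2, of 3]

/-- The automorphism with given values on the generators, and given values of its inverse. -/
def autOfImages {α : Type*} (f g : α → FreeGroup α) (hfg : ∀ i, lift f (g i) = of i)
    (hgf : ∀ i, lift g (f i) = of i) : MulAut (FreeGroup α) :=
  MonoidHom.toMulEquiv (lift f) (lift g) (by ext i; simp [hgf]) (by ext i; simp [hfg])

@[simp] theorem autOfImages_of {α : Type*} (f g : α → FreeGroup α)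
    (hfg : ∀ i, lift f (g i) = of i) (hgf : ∀ i, lift g (f i) = of i) (i : α) :
    autOfImages f g hfg hgf (of i) = f i :=
  lift_apply_of

theorem mulAut_ext {α : Type*} {φ ψ : MulAut (FreeGroup α)} (h : ∀ i, φ (of i) = ψ (of i)) :
    φ = ψ :=
  MulEquiv.toMonoidHom_injective (by ext i; exact h i)

/-- The Nielsen automorphism `a ↦ ab` of the free group of rank four. -/
def nielsenAut : MulAut (FreeGroup (Fin 4)) :=
  autOfImages ![of 0 * of 1, of 1, of 2, of 3] ![of 0 * (of 1)⁻¹, of 1, of 2, of 3]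
    (by simp [Fin.forall_fin_succ]) (by simp [Fin.forall_fin_succ])

/-- The isomorphism from the subgroup generated by the first generator to its image under the
permutation of the first two generators. -/
def zpowersSwapEquiv : Subgroup.zpowers (of (0 : Fin 4)) ≃*
    (Subgroup.zpowers (of (0 : Fin 4))).map
      (freeGroupCongr (Equiv.swap (0 : Fin 4) 1) : FreeGroup (Fin 4) →* FreeGroup (Fin 4)) :=
  (freeGroupCongr (Equiv.swap 0 1)).subgroupMap _

theorem coe_zpowersSwapEquiv (x : Subgroup.zpowers (of (0 : Fin 4))) :
    (zpowersSwapEquiv x : FreeGroup (Fin 4)) = freeGroupCongr (Equiv.swap 0 1) x :=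
  rfl

/-- The HNN extension of a free group of rank four with stable letter conjugating the first
generator into the second. -/
abbrev StableHNN : Type := HNNExtension (FreeGroup (Fin 4)) _ _ zpowersSwapEquiv

theorem t_mul_of_zero : (HNNExtension.t * HNNExtension.of (of 0) : StableHNN) =
    HNNExtension.of (of 1) * HNNExtension.t := by
  have := HNNExtension.t_mul_of (φ := zpowersSwapEquiv) ⟨of 0, Subgroup.mem_zpowers _⟩
  simpa [coe_zpowersSwapEquiv] using this

/-- The free group of rank four as an HNN extension of the subgroup fixed by the Nielsen
automorphism. -/
def toHNN : FreeGroup (Fin 4) →* StableHNN :=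
  lift ![HNNExtension.t, HNNExtension.of (of 0), HNNExtension.of (of 2), HNNExtension.of (of 3)]

/-- The inverse of `toHNN`. -/
def ofHNN : StableHNN →* FreeGroup (Fin 4) :=
  HNNExtension.lift (lift fixedBasis) (of 0) (by
    rintro ⟨-, k, rfl⟩
    simp [coe_zpowersSwapEquiv, fixedBasis])

theorem ofHNN_toHNN (x : FreeGroup (Fin 4)) : ofHNN (toHNN x) = x := by
  rw [← MonoidHom.comp_apply]
  refine DFunLike.congr_fun (?_ : _ = MonoidHom.id _) x
  ext i
  fin_cases i <;> simp [toHNN, ofHNN, fixedBasis]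

theorem toHNN_lift_fixedBasis (x : FreeGroup (Fin 4)) :
    toHNN (lift fixedBasis x) = HNNExtension.of x := by
  rw [← MonoidHom.comp_apply]
  refine DFunLike.congr_fun (?_ : _ = HNNExtension.of) x
  ext i
  fin_cases i <;> simp [toHNN, fixedBasis, t_mul_of_zero]

theorem lift_fixedBasis_injective : Function.Injective (lift fixedBasis) := by
  intro x y h
  apply HNNExtension.of_injective
  rw [← toHNN_lift_fixedBasis, h, toHNN_lift_fixedBasis]

theorem nielsenAut_lift_fixedBasis (x : FreeGroup (Fin 4)) :
    nielsenAut (lift fixedBasis x) = lift fixedBasis x := by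
  rw [← MulEquiv.coe_toMonoidHom, ← MonoidHom.comp_apply]
  congr 1
  ext i
  fin_cases i <;> simp [nielsenAut, fixedBasis]

/-- The elements which the Nielsen automorphism multiplies by a fixed element. -/
theorem exists_eq_of_nielsenAut_eq_mul {x β : FreeGroup (Fin 4)}
    (hx : nielsenAut x = x * lift fixedBasis β) :
    (∃ g, x = lift fixedBasis g) ∨
      (∃ g g', x = lift fixedBasis g * of 0 * lift fixedBasis g' ∧ of 0 = g' * β * g'⁻¹) ∨
      ∃ g g', x = lift fixedBasis g * (of 0)⁻¹ * lift fixedBasis g' ∧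
        (of 1)⁻¹ = g' * β * g'⁻¹ := by
  set τ : StableHNN →* StableHNN :=
    toHNN.comp ((nielsenAut : MulAut (FreeGroup (Fin 4))).toMonoidHom.comp ofHNN) with hτ
  have hof (g : FreeGroup (Fin 4)) : ofHNN (HNNExtension.of g) = lift fixedBasis g :=
    HNNExtension.lift_of ..
  have ht : ofHNN HNNExtension.t = of 0 := HNNExtension.lift_t ..
  have h1 (g : FreeGroup (Fin 4)) : τ (HNNExtension.of g) = HNNExtension.of g := by
    simp [hτ, hof, nielsenAut_lift_fixedBasis, toHNN_lift_fixedBasis]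
  have hτt : τ HNNExtension.t = HNNExtension.t * HNNExtension.of (of 0) := by
    simp [hτ, ht, nielsenAut, toHNN]
  have h2 (u : ℤˣ) : τ (HNNExtension.t ^ (u : ℤ)) = HNNExtension.t ^ (u : ℤ) *
      HNNExtension.of (if u = 1 then of 0 else (of 1)⁻¹) := by
    rcases Int.units_eq_one_or u with rfl | rfl
    · simp [hτt]
    · simp [hτt, t_mul_of_zero]
  have hB : (Subgroup.zpowers (of (0 : Fin 4))).map
      (freeGroupCongr (Equiv.swap (0 : Fin 4) 1) : FreeGroup (Fin 4) →* FreeGroup (Fin 4)) =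
        Subgroup.zpowers (of 1) := by
    rw [MonoidHom.map_zpowers]; simp
  have key := HNNExtension.exists_eq_of_map_eq_mul_of (τ := τ)
    (z := fun u => if u = 1 then of 0 else (of 1)⁻¹) h1 h2
    (by
      intro u
      rcases Int.units_eq_one_or u with rfl | rfl
      · simp
      · simp [hB])
    (by
      intro u v g h
      rcases Int.units_eq_one_or u with rfl | rfl <;> rcases Int.units_eq_one_or v with rfl | rfl
      · have := eq_and_mem_zpowers_of_conj_mem (i := (0 : Fin 4)) (j := 0) (k := 1) (g := g)
          (by simp) (by simpa using h)
        simpa using this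
      · have := eq_and_mem_zpowers_of_conj_mem (i := (0 : Fin 4)) (j := 1) (k := 1) (g := g)
          (by simp) (by simpa [hB] using h)
        simp at this
      · have := eq_and_mem_zpowers_of_conj_mem (i := (1 : Fin 4)) (j := 0) (k := -1) (g := g)
          (by simp) (by simpa using h)
        simp at this
      · have := eq_and_mem_zpowers_of_conj_mem (i := (1 : Fin 4)) (j := 1) (k := -1) (g := g)
          (by simp) (by simpa [hB] using h)
        simpa [hB] using this)
    (x := toHNN x) (β := β)
    (by
      simp only [hτ, MonoidHom.comp_apply, ofHNN_toHNN, MulEquiv.coe_toMonoidHom, hx, _root_.map_mul,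
        toHNN_lift_fixedBasis])
  rcases key with ⟨g, hg⟩ | ⟨g, u, g', hg, hz⟩
  · exact Or.inl ⟨g, by rw [← hof, ← hg, ofHNN_toHNN]⟩
  · have hg' := congrArg ofHNN hg
    rw [ofHNN_toHNN, _root_.map_mul, _root_.map_mul, _root_.map_zpow, hof, hof, ht] at hg'
    rcases Int.units_eq_one_or u with rfl | rfl
    · exact Or.inr (Or.inl ⟨g, g', by simpa using hg', by simpa using hz⟩)
    · exact Or.inr (Or.inr ⟨g, g', by simpa using hg', by simpa using hz⟩)

theorem exists_eq_of_nielsenAut_eq {x : FreeGroup (Fin 4)} (hx : nielsenAut x = x) :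
    ∃ g, x = lift fixedBasis g := by
  rcases exists_eq_of_nielsenAut_eq_mul (x := x) (β := 1) (by simpa using hx) with
    h | ⟨_, _, -, h⟩ | ⟨_, _, -, h⟩
  · exact h
  · simp at h
  · simp at h

section Transvections

variable {α : Type*} [DecidableEq α]

/-- The left transvection `xᵢ ↦ xⱼxᵢ`. -/
def leftTransvection {i j : α} (h : j ≠ i) : MulAut (FreeGroup α) :=
  autOfImages (fun k => if k = i then of j * of i else of k)
    (fun k => if k = i then (of j)⁻¹ * of i else of k)
    (fun k => by by_cases hk : k = i <;> simp [hk, h])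
    (fun k => by by_cases hk : k = i <;> simp [hk, h])

/-- The right transvection `xᵢ ↦ xᵢxⱼ`. -/
def rightTransvection {i j : α} (h : j ≠ i) : MulAut (FreeGroup α) :=
  autOfImages (fun k => if k = i then of i * of j else of k)
    (fun k => if k = i then of i * (of j)⁻¹ else of k)
    (fun k => by by_cases hk : k = i <;> simp [hk, h])
    (fun k => by by_cases hk : k = i <;> simp [hk, h])

@[simp] theorem leftTransvection_of {i j : α} (h : j ≠ i) (k : α) :
    leftTransvection h (of k) = if k = i then of j * of i else of k :=
  autOfImages_of ..

@[simp] theorem rightTransvection_of {i j : α} (h : j ≠ i) (k : α) :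
    rightTransvection h (of k) = if k = i then of i * of j else of k :=
  autOfImages_of ..

theorem leftTransvection_mul_mul {i j k : α} (hij : j ≠ i) (hjk : k ≠ j) (hik : k ≠ i) :
    leftTransvection hjk * leftTransvection hij =
      leftTransvection hij * leftTransvection hik * leftTransvection hjk := by
  apply mulAut_ext
  intro l
  by_cases hi : l = i
  · subst hi; simp [hik, hij.symm, mul_assoc]
  · by_cases hj : l = j <;> simp [hi, hj, hik, hij]

theorem rightTransvection_mul_mul {i j k : α} (hij : j ≠ i) (hjk : k ≠ j) (hik : k ≠ i) :
    rightTransvection hjk * rightTransvection hij =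
      rightTransvection hij * rightTransvection hik * rightTransvection hjk := by
  apply mulAut_ext
  intro l
  by_cases hi : l = i
  · subst hi; simp [hik, hij.symm, mul_assoc]
  · by_cases hj : l = j <;> simp [hi, hj, hik, hij]

end Transvections

/-- The centralizer of the Nielsen automorphism. -/
def nielsenCentralizer : Subgroup (MulAut (FreeGroup (Fin 4))) :=
  Subgroup.centralizer {nielsenAut}

theorem mem_nielsenCentralizer {φ : MulAut (FreeGroup (Fin 4))} :
    φ ∈ nielsenCentralizer ↔ ∀ x, φ (nielsenAut x) = nielsenAut (φ x) := by
  rw [nielsenCentralizer, Subgroup.mem_centralizer_singleton_iff, DFunLike.ext_iff]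
  rfl

theorem mem_nielsenCentralizer_of {φ : MulAut (FreeGroup (Fin 4))}
    (h : ∀ i, φ (nielsenAut (of i)) = nielsenAut (φ (of i))) : φ ∈ nielsenCentralizer := by
  rw [nielsenCentralizer, Subgroup.mem_centralizer_singleton_iff]
  exact mulAut_ext h

theorem leftTransvection_mem {i j : Fin 4} (h : j ≠ i) (hi : i ≠ 1) (hj : j ≠ 0) :
    leftTransvection h ∈ nielsenCentralizer := by
  apply mem_nielsenCentralizer_of
  fin_cases i <;> fin_cases j <;>
    simp [nielsenAut, Fin.forall_fin_succ, mul_assoc] at h hi hj ⊢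

theorem rightTransvection_mem {i j : Fin 4} (h : j ≠ i) (hi : i ≠ 1) (hi' : i ≠ 0) (hj : j ≠ 0) :
    rightTransvection h ∈ nielsenCentralizer := by
  apply mem_nielsenCentralizer_of
  fin_cases i <;> fin_cases j <;>
    simp [nielsenAut, Fin.forall_fin_succ] at h hi' hi hj ⊢

/-- The inversion of the third generator. -/
def inversionAut : MulAut (FreeGroup (Fin 4)) :=
  autOfImages ![of 0, of 1, (of 2)⁻¹, of 3] ![of 0, of 1, (of 2)⁻¹, of 3]
    (by simp [Fin.forall_fin_succ]) (by simp [Fin.forall_fin_succ])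

/-- The transposition of the last two generators. -/
def swapAut : MulAut (FreeGroup (Fin 4)) :=
  autOfImages ![of 0, of 1, of 3, of 2] ![of 0, of 1, of 3, of 2]
    (by simp [Fin.forall_fin_succ]) (by simp [Fin.forall_fin_succ])

/-- The automorphism inverting the stable letter of the HNN extension. -/
def flipAut : MulAut (FreeGroup (Fin 4)) :=
  autOfImages ![(of 0)⁻¹, of 0 * (of 1)⁻¹ * (of 0)⁻¹, of 2, of 3]
    ![(of 0)⁻¹, of 0 * (of 1)⁻¹ * (of 0)⁻¹, of 2, of 3]
    (by simp [Fin.forall_fin_succ, mul_assoc]) (by simp [Fin.forall_fin_succ, mul_assoc])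

theorem nielsenAut_mem : nielsenAut ∈ nielsenCentralizer :=
  mem_nielsenCentralizer.2 fun _ => rfl

theorem inversionAut_mem : inversionAut ∈ nielsenCentralizer :=
  mem_nielsenCentralizer_of (by simp [Fin.forall_fin_succ, nielsenAut, inversionAut])

theorem swapAut_mem : swapAut ∈ nielsenCentralizer :=
  mem_nielsenCentralizer_of (by simp [Fin.forall_fin_succ, nielsenAut, swapAut])

theorem flipAut_mem : flipAut ∈ nielsenCentralizer :=
  mem_nielsenCentralizer_of (by simp [Fin.forall_fin_succ, nielsenAut, flipAut, mul_assoc])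

theorem conj_of_mem (i : Fin 4) (hi : i ≠ 0) : MulAut.conj (of i) ∈ nielsenCentralizer := by
  apply mem_nielsenCentralizer_of
  fin_cases i <;> simp [nielsenAut, mul_assoc] at hi ⊢

theorem inversionAut_mul_self : inversionAut * inversionAut = 1 :=
  mulAut_ext (by simp [Fin.forall_fin_succ, inversionAut])

theorem swapAut_mul_self : swapAut * swapAut = 1 :=
  mulAut_ext (by simp [Fin.forall_fin_succ, swapAut])

theorem flipAut_mul_self : flipAut * flipAut = 1 :=
  mulAut_ext (by simp [Fin.forall_fin_succ, flipAut, mul_assoc])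

/-- A subgroup of the centralizer containing all commutators and the generators of the
abelianization. -/
structure IsLarge (K : Subgroup (MulAut (FreeGroup (Fin 4)))) : Prop where
  le : K ≤ nielsenCentralizer
  commutator_mem : ∀ φ ∈ nielsenCentralizer, ∀ ψ ∈ nielsenCentralizer, φ * ψ * φ⁻¹ * ψ⁻¹ ∈ K
  inversion_mem : inversionAut ∈ K
  flip_mem : flipAut ∈ K
  transvection_mem : rightTransvection (i := (2 : Fin 4)) (j := 3) (by decide) ∈ K

namespace IsLarge

variable {K : Subgroup (MulAut (FreeGroup (Fin 4)))} (hK : IsLarge K)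
include hK

theorem conj_mem {φ ψ : MulAut (FreeGroup (Fin 4))} (hφ : φ ∈ K) (hψ : ψ ∈ nielsenCentralizer) :
    ψ * φ * ψ⁻¹ ∈ K := by
  have := mul_mem (hK.commutator_mem ψ hψ φ (hK.le hφ)) hφ
  rwa [inv_mul_cancel_right] at this

theorem mem_of_mul_eq {φ ψ χ : MulAut (FreeGroup (Fin 4))} (hφ : φ ∈ nielsenCentralizer)
    (hψ : ψ ∈ nielsenCentralizer) (h : φ * ψ = ψ * χ * φ) : χ ∈ K := by
  have := hK.commutator_mem ψ⁻¹ (inv_mem hψ) φ hφ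
  have e : ψ⁻¹ * φ * ψ⁻¹⁻¹ * φ⁻¹ = χ := by
    rw [inv_inv, mul_assoc ψ⁻¹, h]; group
  rwa [e] at this

theorem leftTransvection_mem_of_ne {i k : Fin 4} (hik : k ≠ i) {j : Fin 4} (hij : j ≠ i)
    (hjk : k ≠ j) (hi : i ≠ 1) (hj : j ≠ 1) (hj' : j ≠ 0) (hk : k ≠ 0) :
    leftTransvection hik ∈ K :=
  hK.mem_of_mul_eq (leftTransvection_mem hjk hj hk) (leftTransvection_mem hij hi hj')
    (leftTransvection_mul_mul hij hjk hik)

theorem rightTransvection_mem_of_ne {i k : Fin 4} (hik : k ≠ i) {j : Fin 4} (hij : j ≠ i)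
    (hjk : k ≠ j) (hi : i ≠ 1) (hi' : i ≠ 0) (hj : j ≠ 1) (hj' : j ≠ 0) (hk : k ≠ 0) :
    rightTransvection hik ∈ K :=
  hK.mem_of_mul_eq (rightTransvection_mem hjk hj hj' hk) (rightTransvection_mem hij hi hi' hj')
    (rightTransvection_mul_mul hij hjk hik)

theorem swap_mem : swapAut ∈ K := by
  have hs : swapAut⁻¹ = swapAut := inv_eq_of_mul_eq_one_left swapAut_mul_self
  have h1 : leftTransvection (i := (2 : Fin 4)) (j := 3) (by decide) ∈ K := by
    have : leftTransvection (i := (2 : Fin 4)) (j := 3) (by decide) =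
        inversionAut * (rightTransvection (i := (2 : Fin 4)) (j := 3) (by decide))⁻¹ *
          inversionAut⁻¹ := by
      rw [eq_mul_inv_iff_mul_eq, eq_mul_inv_iff_mul_eq]
      exact mulAut_ext (by simp [Fin.forall_fin_succ, inversionAut])
    rw [this]
    exact hK.conj_mem (inv_mem hK.transvection_mem) inversionAut_mem
  have h2 := hK.conj_mem h1 swapAut_mem
  have h3 := hK.conj_mem hK.inversion_mem swapAut_mem
  have : swapAut = rightTransvection (i := (2 : Fin 4)) (j := 3) (by decide) *
      (swapAut * inversionAut * swapAut⁻¹) *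
      (swapAut * leftTransvection (i := (2 : Fin 4)) (j := 3) (by decide) * swapAut⁻¹) *
      (leftTransvection (i := (2 : Fin 4)) (j := 3) (by decide))⁻¹ := by
    rw [eq_mul_inv_iff_mul_eq, hs]
    exact mulAut_ext (by simp [Fin.forall_fin_succ, inversionAut, swapAut])
  rw [this]
  exact mul_mem (mul_mem (mul_mem hK.transvection_mem h3) h2) (inv_mem h1)

theorem conj_of_one_mem : MulAut.conj (of 1) ∈ K := by
  refine hK.mem_of_mul_eq (φ := rightTransvection (i := (2 : Fin 4)) (j := 1) (by decide))
    (ψ := MulAut.conj (of 2)) (rightTransvection_mem _ (by decide) (by decide)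
      (by decide)) (conj_of_mem 2 (by decide)) (MulEquiv.ext fun x => ?_)
  simp [mul_assoc]

theorem nielsenAut_mem : nielsenAut ∈ K := by
  have h1 := hK.rightTransvection_mem_of_ne (i := 2) (k := 1) (by decide) (j := 3) (by decide)
    (by decide) (by decide) (by decide) (by decide) (by decide) (by decide)
  have h2 := hK.rightTransvection_mem_of_ne (i := 3) (k := 1) (by decide) (j := 2) (by decide)
    (by decide) (by decide) (by decide) (by decide) (by decide) (by decide)
  have h3 := hK.leftTransvection_mem_of_ne (i := 2) (k := 1) (by decide) (j := 3) (by decide)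
    (by decide) (by decide) (by decide) (by decide) (by decide)
  have h4 := hK.leftTransvection_mem_of_ne (i := 3) (k := 1) (by decide) (j := 2) (by decide)
    (by decide) (by decide) (by decide) (by decide) (by decide)
  have h5 := hK.leftTransvection_mem_of_ne (i := 0) (k := 1) (by decide) (j := 2) (by decide)
    (by decide) (by decide) (by decide) (by decide) (by decide)
  have e : MulAut.conj (of 1) * nielsenAut *
      (rightTransvection (i := (2 : Fin 4)) (j := 1) (by decide) *
        rightTransvection (i := (3 : Fin 4)) (j := 1) (by decide)) =
      leftTransvection (i := (2 : Fin 4)) (j := 1) (by decide) *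
      leftTransvection (i := (3 : Fin 4)) (j := 1) (by decide) *
      leftTransvection (i := (0 : Fin 4)) (j := 1) (by decide) :=
    mulAut_ext (by simp [Fin.forall_fin_succ, nielsenAut, mul_assoc])
  rw [← eq_mul_inv_iff_mul_eq, ← eq_inv_mul_iff_mul_eq] at e
  rw [e]
  exact mul_mem (inv_mem hK.conj_of_one_mem) (mul_mem (mul_mem (mul_mem h3 h4) h5)
    (inv_mem (mul_mem h1 h2)))

end IsLarge

/-- The tuple `f` of words describes the values on `fixedBasis` of an element of `K`. -/
def IsRealized (K : Subgroup (MulAut (FreeGroup (Fin 4)))) (f : Fin 4 → FreeGroup (Fin 4)) : Prop :=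
  ∃ m ∈ K, ∀ i, m (fixedBasis i) = lift fixedBasis (f i)

theorem apply_lift_fixedBasis {m : MulAut (FreeGroup (Fin 4))} {f : Fin 4 → FreeGroup (Fin 4)}
    (h : ∀ i, m (fixedBasis i) = lift fixedBasis (f i)) (w : FreeGroup (Fin 4)) :
    m (lift fixedBasis w) = lift fixedBasis (lift f w) := by
  have : m.toMonoidHom.comp (lift fixedBasis) = (lift fixedBasis).comp (lift f) := by
    ext i; simp [h]
  exact DFunLike.congr_fun this w

namespace IsRealized

variable {K : Subgroup (MulAut (FreeGroup (Fin 4)))} {f g h : Fin 4 → FreeGroup (Fin 4)}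

theorem comp (hf : IsRealized K f) (hg : IsRealized K g) (hfg : ∀ i, lift f (g i) = h i) :
    IsRealized K h := by
  obtain ⟨m, hm, hm'⟩ := hf
  obtain ⟨n, hn, hn'⟩ := hg
  exact ⟨m * n, mul_mem hm hn, fun i => by
    rw [MulAut.mul_apply, hn', apply_lift_fixedBasis hm', hfg]⟩

theorem inv (hf : IsRealized K f) (hfg : ∀ i, lift f (g i) = of i) : IsRealized K g := by
  obtain ⟨m, hm, hm'⟩ := hf
  refine ⟨m⁻¹, inv_mem hm, fun i => m.injective ?_⟩
  rw [apply_lift_fixedBasis hm', hfg, MulAut.apply_inv_self, lift_apply_of]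

theorem conj (hf : IsRealized K f) (hg : IsRealized K g)
    (hfg : ∀ i, lift f (lift g (f i)) = h i) : IsRealized K h :=
  (hf.comp hg fun _ => rfl).comp hf fun i => by
    rw [← hfg, ← MonoidHom.comp_apply]
    congr 1
    ext j
    simp

end IsRealized

/-- The letter with the last two generators exchanged. -/
theorem exists_swap_letter (x : Fin 4 × Bool) (hx : x.1 ≠ 3) :
    ∃ y : Fin 4 × Bool, y.1 ≠ 2 ∧
      lift ![of 0, of 1, of 3, of 2] (letterVal of y) = letterVal of x := by
  obtain ⟨j, ε⟩ := x
  refine ⟨(Equiv.swap 2 3 j, ε), ?_, ?_⟩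
  · fin_cases j <;> simp at hx ⊢ <;> decide
  · fin_cases j <;> cases ε <;> simp [letterVal] <;> rfl

namespace IsLarge

variable {K : Subgroup (MulAut (FreeGroup (Fin 4)))} (hK : IsLarge K)
include hK

theorem isRealized_inversion : IsRealized K ![of 0, of 1, (of 2)⁻¹, of 3] :=
  ⟨inversionAut, hK.inversion_mem, by simp [Fin.forall_fin_succ, fixedBasis, inversionAut]⟩

theorem isRealized_swap : IsRealized K ![of 0, of 1, of 3, of 2] :=
  ⟨swapAut, hK.swap_mem, by simp [Fin.forall_fin_succ, fixedBasis, swapAut]⟩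

theorem isRealized_inversion' : IsRealized K ![of 0, of 1, of 2, (of 3)⁻¹] :=
  hK.isRealized_swap.conj hK.isRealized_inversion (by simp [Fin.forall_fin_succ])

theorem isRealized_flip : IsRealized K ![(of 1)⁻¹, (of 0)⁻¹, of 2, of 3] :=
  ⟨flipAut, hK.flip_mem, by simp [Fin.forall_fin_succ, fixedBasis, flipAut, mul_assoc]⟩

theorem isRealized_mul_right_two (x : Fin 4 × Bool) (hx : x.1 ≠ 2) :
    IsRealized K (Function.update of 2 (of 2 * letterVal of x)) := by
  have h0 : IsRealized K (Function.update of 2 (of 2 * of 0)) :=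
    ⟨_, hK.rightTransvection_mem_of_ne (i := 2) (k := 1) (by decide) (j := 3) (by decide)
      (by decide) (by decide) (by decide) (by decide) (by decide) (by decide),
      by simp [Fin.forall_fin_succ, fixedBasis]⟩
  have h3 : IsRealized K (Function.update of 2 (of 2 * of 3)) :=
    ⟨_, hK.transvection_mem, by simp [Fin.forall_fin_succ, fixedBasis]⟩
  have h0' : IsRealized K (Function.update of 2 (of 2 * (of 0)⁻¹)) :=
    h0.inv (by simp [Fin.forall_fin_succ])
  have h3' : IsRealized K (Function.update of 2 (of 2 * (of 3)⁻¹)) :=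
    h3.inv (by simp [Fin.forall_fin_succ])
  have h1' : IsRealized K (Function.update of 2 (of 2 * (of 1)⁻¹)) :=
    hK.isRealized_flip.conj h0 (by simp [Fin.forall_fin_succ])
  have h1 : IsRealized K (Function.update of 2 (of 2 * of 1)) :=
    hK.isRealized_flip.conj h0' (by simp [Fin.forall_fin_succ])
  obtain ⟨j, ε⟩ := x
  fin_cases j <;> cases ε <;> first | exact absurd rfl hx | assumption

theorem isRealized_mul_left_two (x : Fin 4 × Bool) (hx : x.1 ≠ 2) :
    IsRealized K (Function.update of 2 (letterVal of x * of 2)) := by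
  refine hK.isRealized_inversion.conj (hK.isRealized_mul_right_two (x.1, !x.2) hx) ?_
  obtain ⟨j, ε⟩ := x
  fin_cases j <;> cases ε <;> simp [Fin.forall_fin_succ, letterVal] at hx ⊢

theorem isRealized_conj_one (x : Fin 4 × Bool) (hx : x.1 ≠ 1) :
    IsRealized K (Function.update of 1 (letterVal of x * of 1 * (letterVal of x)⁻¹)) := by
  have h0 : IsRealized K (Function.update of 1 (of 0 * of 1 * (of 0)⁻¹)) :=
    ⟨_, hK.leftTransvection_mem_of_ne (i := 0) (k := 1) (by decide) (j := 2) (by decide)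
      (by decide) (by decide) (by decide) (by decide) (by decide),
      by simp [Fin.forall_fin_succ, fixedBasis, mul_assoc]⟩
  have h2 : IsRealized K (Function.update of 1 (of 2 * of 1 * (of 2)⁻¹)) :=
    ⟨_, hK.leftTransvection_mem_of_ne (i := 0) (k := 2) (by decide) (j := 3) (by decide)
      (by decide) (by decide) (by decide) (by decide) (by decide),
      by simp [Fin.forall_fin_succ, fixedBasis, mul_assoc]⟩
  have h3 : IsRealized K (Function.update of 1 (of 3 * of 1 * (of 3)⁻¹)) :=
    ⟨_, hK.leftTransvection_mem_of_ne (i := 0) (k := 3) (by decide) (j := 2) (by decide)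
      (by decide) (by decide) (by decide) (by decide) (by decide),
      by simp [Fin.forall_fin_succ, fixedBasis, mul_assoc]⟩
  have h0' : IsRealized K (Function.update of 1 ((of 0)⁻¹ * of 1 * of 0)) :=
    h0.inv (by simp [Fin.forall_fin_succ, mul_assoc])
  have h2' : IsRealized K (Function.update of 1 ((of 2)⁻¹ * of 1 * of 2)) :=
    h2.inv (by simp [Fin.forall_fin_succ, mul_assoc])
  have h3' : IsRealized K (Function.update of 1 ((of 3)⁻¹ * of 1 * of 3)) :=
    h3.inv (by simp [Fin.forall_fin_succ, mul_assoc])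
  obtain ⟨j, ε⟩ := x
  fin_cases j <;> cases ε <;> first | exact absurd rfl hx | assumption

theorem isRealized_conj_zero (x : Fin 4 × Bool) (hx : x.1 ≠ 0) :
    IsRealized K (Function.update of 0 (letterVal of x * of 0 * (letterVal of x)⁻¹)) := by
  obtain ⟨y, hy, hxy⟩ : ∃ y : Fin 4 × Bool, y.1 ≠ 1 ∧
      lift ![(of 1)⁻¹, (of 0)⁻¹, of 2, of 3] (letterVal of y) = letterVal of x := by
    obtain ⟨j, ε⟩ := x
    refine ⟨(Equiv.swap 0 1 j, if j = 1 then !ε else ε), ?_, ?_⟩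
    · fin_cases j <;> simp at hx ⊢ <;> decide
    · fin_cases j <;> cases ε <;> simp [letterVal] at hx ⊢ <;> rfl
  refine hK.isRealized_flip.conj (hK.isRealized_conj_one y hy) ?_
  simp [Fin.forall_fin_succ, hxy, mul_assoc]

theorem isRealized_mul_right (x : Fin 4 × Bool) {i : Fin 4} (hi : i ∉ ({0, 1} : Set (Fin 4)))
    (hx : x.1 ≠ i) : IsRealized K (Function.update of i (of i * letterVal of x)) := by
  obtain rfl | rfl : i = 2 ∨ i = 3 := by fin_cases i <;> simp at hi ⊢
  · exact hK.isRealized_mul_right_two x hx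
  · obtain ⟨y, hy, hxy⟩ := exists_swap_letter x hx
    exact hK.isRealized_swap.conj (hK.isRealized_mul_right_two y hy)
      (by simp [Fin.forall_fin_succ, hxy])

theorem isRealized_mul_left (x : Fin 4 × Bool) {i : Fin 4} (hi : i ∉ ({0, 1} : Set (Fin 4)))
    (hx : x.1 ≠ i) : IsRealized K (Function.update of i (letterVal of x * of i)) := by
  obtain rfl | rfl : i = 2 ∨ i = 3 := by fin_cases i <;> simp at hi ⊢
  · exact hK.isRealized_mul_left_two x hx
  · obtain ⟨y, hy, hxy⟩ := exists_swap_letter x hx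
    exact hK.isRealized_swap.conj (hK.isRealized_mul_left_two y hy)
      (by simp [Fin.forall_fin_succ, hxy])

theorem isRealized_conj (x : Fin 4 × Bool) {i : Fin 4} (hi : i ∈ ({0, 1} : Set (Fin 4)))
    (hx : x.1 ≠ i) :
    IsRealized K (Function.update of i (letterVal of x * of i * (letterVal of x)⁻¹)) := by
  obtain rfl | rfl := hi
  · exact hK.isRealized_conj_zero x hx
  · exact hK.isRealized_conj_one x hx

end IsLarge

theorem nielsenAut_zpow_of_zero (k : ℤ) : (nielsenAut ^ k) (of 0) = of 0 * of 1 ^ k := by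
  have h : nielsenAut⁻¹ (of 0) = of 0 * (of 1)⁻¹ :=
    nielsenAut.injective (by simp [nielsenAut])
  have h' : nielsenAut⁻¹ (of 1) = of 1 := nielsenAut.injective (by simp [nielsenAut])
  induction k using Int.induction_on with
  | zero => simp
  | succ k ih =>
    rw [add_comm, zpow_add, MulAut.mul_apply, ih, zpow_one, _root_.map_mul, _root_.map_zpow,
      zpow_add, zpow_one, ← mul_assoc]
    simp [nielsenAut]
  | pred k ih =>
    rw [sub_eq_neg_add, zpow_add, MulAut.mul_apply, ih, zpow_neg_one, _root_.map_mul,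
      _root_.map_zpow, zpow_add, zpow_neg_one, ← mul_assoc, h, h']

theorem nielsenAut_zpow_of {i : Fin 4} (hi : i ≠ 0) (k : ℤ) : (nielsenAut ^ k) (of i) = of i := by
  have h : nielsenAut (of i) = of i := by fin_cases i <;> simp [nielsenAut] at hi ⊢
  exact zpow_mem (MulAction.mem_stabilizer_iff.2 h :
    nielsenAut ∈ MulAction.stabilizer (MulAut (FreeGroup (Fin 4))) (of i)) k

/-- An automorphism fixing `fixedBasis` is a power of the Nielsen automorphism. -/
theorem mem_zpowers_nielsenAut {ψ : MulAut (FreeGroup (Fin 4))}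
    (h : ∀ i, ψ (fixedBasis i) = fixedBasis i) : ψ ∈ Subgroup.zpowers nielsenAut := by
  have h0 := h 0
  have h1 := h 1
  have h2 := h 2
  have h3 := h 3
  simp only [fixedBasis, Matrix.cons_val, _root_.map_mul, _root_.map_inv] at h0 h1 h2 h3
  rw [h0] at h1
  obtain ⟨k, hk⟩ := mem_zpowers_of_commute (i := 1) (g := (of 0)⁻¹ * ψ (of 0)) <| by
    rw [mul_inv_eq_iff_eq_mul] at h1
    rw [commute_iff_eq, mul_assoc, h1]
    group
  refine ⟨k, mulAut_ext fun i => ?_⟩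
  simp only [eq_inv_mul_iff_mul_eq] at hk ⊢
  fin_cases i
  · exact (nielsenAut_zpow_of_zero k).trans hk
  · exact (nielsenAut_zpow_of (by decide) k).trans h0.symm
  · exact (nielsenAut_zpow_of (by decide) k).trans h2.symm
  · exact (nielsenAut_zpow_of (by decide) k).trans h3.symm

section Centralizer

variable {φ : MulAut (FreeGroup (Fin 4))} (hφ : φ ∈ nielsenCentralizer)
include hφ

theorem exists_apply_fixedBasis :
    ∃ U : Fin 4 → FreeGroup (Fin 4), ∀ i, φ (fixedBasis i) = lift fixedBasis (U i) := by
  refine Classical.axiomOfChoice fun i => exists_eq_of_nielsenAut_eq ?_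
  rw [← mem_nielsenCentralizer.1 hφ, ← lift_apply_of (f := fixedBasis), nielsenAut_lift_fixedBasis]

theorem bijective_lift_of_apply_fixedBasis {U : Fin 4 → FreeGroup (Fin 4)}
    (hU : ∀ i, φ (fixedBasis i) = lift fixedBasis (U i)) : Function.Bijective (lift U) := by
  refine ⟨fun x y h => lift_fixedBasis_injective (φ.injective ?_), fun y => ?_⟩
  · rw [apply_lift_fixedBasis hU, h, apply_lift_fixedBasis hU]
  · obtain ⟨g, hg⟩ := exists_eq_of_nielsenAut_eq (x := φ⁻¹ (lift fixedBasis y)) <| by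
      rw [← mem_nielsenCentralizer.1 (inv_mem hφ), nielsenAut_lift_fixedBasis]
    refine ⟨g, lift_fixedBasis_injective ?_⟩
    rw [← apply_lift_fixedBasis hU, ← hg, MulAut.apply_inv_self]

/-- An element of the centralizer preserves or reverses the stable letter of the HNN extension. -/
theorem exists_apply_of_zero : ∃ g g' : FreeGroup (Fin 4),
    φ (of 0) = lift fixedBasis g * of 0 * lift fixedBasis g' ∨
      φ (of 0) = lift fixedBasis g * (of 0)⁻¹ * lift fixedBasis g' := by
  obtain ⟨U, hU⟩ := exists_apply_fixedBasis hφ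
  have h : nielsenAut (φ (of 0)) = φ (of 0) * lift fixedBasis (U 0) := by
    rw [← mem_nielsenCentralizer.1 hφ, ← hU, ← _root_.map_mul]
    simp [nielsenAut, fixedBasis]
  obtain ⟨g, hg⟩ | ⟨g, g', hg, -⟩ | ⟨g, g', hg, -⟩ := exists_eq_of_nielsenAut_eq_mul h
  · rw [hg, nielsenAut_lift_fixedBasis, left_eq_mul, ← hU, map_eq_one_iff _ φ.injective] at h
    exact absurd h (of_ne_one 1)
  · exact ⟨g, g', .inl hg⟩
  · exact ⟨g, g', .inr hg⟩

theorem exists_conj_of_apply_of_zero {g g' : FreeGroup (Fin 4)}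
    (hg : φ (of 0) = lift fixedBasis g * of 0 * lift fixedBasis g') {U : Fin 4 → FreeGroup (Fin 4)}
    (hU : ∀ i, φ (fixedBasis i) = lift fixedBasis (U i)) {i : Fin 4}
    (hi : i ∈ ({0, 1} : Set (Fin 4))) : ∃ p, U i = p * of i * p⁻¹ := by
  have hn : nielsenAut (of 0) = of 0 * of 1 := by simp [nielsenAut]
  have h0 : φ (of 1) = lift fixedBasis (g'⁻¹ * of 0 * g') := by
    have h := mem_nielsenCentralizer.1 hφ (of 0)
    simp only [hn, _root_.map_mul, hg, nielsenAut_lift_fixedBasis] at h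
    simp only [mul_assoc, mul_right_inj] at h
    rw [← eq_inv_mul_iff_mul_eq] at h
    simp [h, fixedBasis, mul_assoc]
  obtain rfl | rfl := hi
  · exact ⟨g'⁻¹, lift_fixedBasis_injective (by rw [← hU, inv_inv, ← h0]; rfl)⟩
  · refine ⟨g, lift_fixedBasis_injective ?_⟩
    rw [← hU]
    simp [fixedBasis, h0, hg, mul_assoc]

end Centralizer

section Standard

variable {α : Type*} [DecidableEq α]

theorem exists_eq_letterVal_of_norm_eq_one {g : FreeGroup α} (h : norm g = 1) :
    ∃ x, g = letterVal of x := by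
  obtain ⟨x, hx⟩ := List.length_eq_one_iff.1 h
  refine ⟨x, ?_⟩
  rw [← mk_toWord (x := g), hx]
  obtain ⟨i, ε⟩ := x
  cases ε <;> rfl

theorem expSum_letterVal (j : α) (x : α × Bool) :
    Multiplicative.toAdd (expSum j (letterVal of x)) =
      if x.1 = j then cond x.2 (1 : ℤ) (-1) else 0 := by
  obtain ⟨i, ε⟩ := x
  cases ε <;> by_cases h : i = j <;> simp [letterVal, h]

theorem eq_of_norm_eq_one_of_conj {g p : FreeGroup α} {i : α} (h : norm g = 1)
    (hg : g = p * of i * p⁻¹) : g = of i := by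
  obtain ⟨⟨j, ε⟩, hx⟩ := exists_eq_letterVal_of_norm_eq_one h
  have h1 := congrArg (fun x => Multiplicative.toAdd (expSum i x)) hx
  rw [hg] at h1
  simp only [expSum_letterVal] at h1
  by_cases hj : j = i
  · subst hj
    cases ε
    · simp at h1
    · exact hx
  · simp [hj] at h1

theorem fst_ne_fst_of_injective_lift {U : α → FreeGroup α} (hU : Function.Injective (lift U))
    {i j : α} (hij : i ≠ j) {x y : α × Bool} (hx : U i = letterVal of x)
    (hy : U j = letterVal of y) : x.1 ≠ y.1 := by
  intro h
  have h1 : U i = U j ∨ U i = (U j)⁻¹ := by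
    obtain ⟨k, ε⟩ := x
    obtain ⟨l, δ⟩ := y
    obtain rfl : k = l := h
    rw [hx, hy]
    cases ε <;> cases δ <;> simp [letterVal]
  have h2 : of i = of j ∨ of i = (of j)⁻¹ := by
    refine h1.imp (fun h => hU ?_) fun h => hU ?_ <;> simp [h]
  rcases h2 with h | h <;>
  · have := congrArg (fun x => Multiplicative.toAdd (expSum i x)) h
    simp [hij.symm] at this

end Standard

theorem IsRealized.mem_of_comp {K : Subgroup (MulAut (FreeGroup (Fin 4)))}
    {f U V : Fin 4 → FreeGroup (Fin 4)} (hf : IsRealized K f)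
    (hfV : ∀ i, lift U (f i) = V i)
    (hV : ∀ φ : MulAut (FreeGroup (Fin 4)), (∀ i, φ (fixedBasis i) = lift fixedBasis (V i)) → φ ∈ K)
    {φ : MulAut (FreeGroup (Fin 4))} (hU : ∀ i, φ (fixedBasis i) = lift fixedBasis (U i)) :
    φ ∈ K := by
  obtain ⟨m, hm, hmf⟩ := hf
  refine (Subgroup.mul_mem_cancel_right _ hm).1 (hV (φ * m) fun i => ?_)
  rw [MulAut.mul_apply, hmf, apply_lift_fixedBasis hU, hfV]

namespace IsLarge

variable {K : Subgroup (MulAut (FreeGroup (Fin 4)))} (hK : IsLarge K)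
include hK

theorem mem_of_isRealized {φ : MulAut (FreeGroup (Fin 4))} {U : Fin 4 → FreeGroup (Fin 4)}
    (hU : ∀ i, φ (fixedBasis i) = lift fixedBasis (U i)) (h : IsRealized K U) : φ ∈ K := by
  obtain ⟨m, hm, hmU⟩ := h
  have : m⁻¹ * φ ∈ Subgroup.zpowers nielsenAut := mem_zpowers_nielsenAut fun i =>
    m.injective (by rw [MulAut.mul_apply, hU, ← hmU, MulAut.inv_apply_self])
  exact (Subgroup.mul_mem_cancel_left _ (inv_mem hm)).1
    (Subgroup.zpowers_le.2 hK.nielsenAut_mem this)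

theorem isRealized_of_letters {x y : Fin 4 × Bool}
    (hx0 : x.1 ≠ 0) (hx1 : x.1 ≠ 1) (hy0 : y.1 ≠ 0) (hy1 : y.1 ≠ 1) (hxy : x.1 ≠ y.1) :
    IsRealized K ![of 0, of 1, letterVal of x, letterVal of y] := by
  have h1 : IsRealized K ![of 0, of 1, of 2, of 3] :=
    ⟨1, one_mem K, by simp [Fin.forall_fin_succ]⟩
  have h2 := hK.isRealized_inversion
  have h3 := hK.isRealized_inversion'
  have h4 : IsRealized K ![of 0, of 1, (of 2)⁻¹, (of 3)⁻¹] :=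
    h2.comp h3 (by simp [Fin.forall_fin_succ])
  have h5 := hK.isRealized_swap
  have h6 : IsRealized K ![of 0, of 1, of 3, (of 2)⁻¹] := h2.comp h5 (by simp [Fin.forall_fin_succ])
  have h7 : IsRealized K ![of 0, of 1, (of 3)⁻¹, of 2] := h3.comp h5 (by simp [Fin.forall_fin_succ])
  have h8 : IsRealized K ![of 0, of 1, (of 3)⁻¹, (of 2)⁻¹] :=
    h4.comp h5 (by simp [Fin.forall_fin_succ])
  obtain ⟨i, ε⟩ := x
  obtain ⟨j, δ⟩ := y
  simp only at hx0 hx1 hy0 hy1 hxy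
  have hij : i = 2 ∧ j = 3 ∨ i = 3 ∧ j = 2 := by omega
  obtain ⟨rfl, rfl⟩ | ⟨rfl, rfl⟩ := hij <;> cases ε <;> cases δ <;> assumption

theorem isRealized_of_norm_eq_one {U : Fin 4 → FreeGroup (Fin 4)}
    (hU : Function.Injective (lift U))
    (hκ : ∀ i ∈ ({0, 1} : Set (Fin 4)), ∃ p, U i = p * of i * p⁻¹)
    (h : ∀ i, norm (U i) = 1) : IsRealized K U := by
  have h0 : U 0 = of 0 := eq_of_norm_eq_one_of_conj (h 0) (hκ 0 (by simp)).choose_spec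
  have h1 : U 1 = of 1 := eq_of_norm_eq_one_of_conj (h 1) (hκ 1 (by simp)).choose_spec
  obtain ⟨x, hx⟩ := exists_eq_letterVal_of_norm_eq_one (h 2)
  obtain ⟨y, hy⟩ := exists_eq_letterVal_of_norm_eq_one (h 3)
  have e : U = ![of 0, of 1, letterVal of x, letterVal of y] := by
    funext i
    fin_cases i <;> assumption
  have h0' : U 0 = letterVal of (0, true) := h0
  have h1' : U 1 = letterVal of (1, true) := h1
  rw [e]
  exact hK.isRealized_of_letters (fst_ne_fst_of_injective_lift hU (by decide) hx h0')
    (fst_ne_fst_of_injective_lift hU (by decide) hx h1')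
    (fst_ne_fst_of_injective_lift hU (by decide) hy h0')
    (fst_ne_fst_of_injective_lift hU (by decide) hy h1')
    (fst_ne_fst_of_injective_lift hU (by decide) hx hy)

theorem mem_of_conj {U : Fin 4 → FreeGroup (Fin 4)} (hU : Function.Bijective (lift U))
    (hκ : ∀ i ∈ ({0, 1} : Set (Fin 4)), ∃ p, U i = p * of i * p⁻¹) :
    ∀ φ : MulAut (FreeGroup (Fin 4)),
      (∀ i, φ (fixedBasis i) = lift fixedBasis (U i)) → φ ∈ K := by
  refine nielsen_induction (κ := {0, 1}) (S := fun U => ∀ φ : MulAut (FreeGroup (Fin 4)),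
    (∀ i, φ (fixedBasis i) = lift fixedBasis (U i)) → φ ∈ K) ?_ ?_ ?_ ?_ U hU hκ
  · exact fun U hU hκ hn φ h => hK.mem_of_isRealized h (hK.isRealized_of_norm_eq_one hU.1 hκ hn)
  · refine fun U x i hx hi hS φ h =>
      (hK.isRealized_mul_left x hi hx).mem_of_comp (fun j => ?_) hS h
    by_cases hj : j = i
    · subst hj; simp [lift_letterVal_of]
    · simp [hj]
  · refine fun U x i hx hi hS φ h =>
      (hK.isRealized_mul_right x hi hx).mem_of_comp (fun j => ?_) hS h
    by_cases hj : j = i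
    · subst hj; simp [lift_letterVal_of]
    · simp [hj]
  · refine fun U x i hx hi hS φ h =>
      (hK.isRealized_conj x hi hx).mem_of_comp (fun j => ?_) hS h
    by_cases hj : j = i
    · subst hj; simp [lift_letterVal_of]
    · simp [hj]

theorem mem_of_apply_of_zero {φ : MulAut (FreeGroup (Fin 4))} (hφ : φ ∈ nielsenCentralizer)
    {g g' : FreeGroup (Fin 4)} (hg : φ (of 0) = lift fixedBasis g * of 0 * lift fixedBasis g') :
    φ ∈ K := by
  obtain ⟨U, hU⟩ := exists_apply_fixedBasis hφ
  exact hK.mem_of_conj (bijective_lift_of_apply_fixedBasis hφ hU)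
    (fun i hi => exists_conj_of_apply_of_zero hφ hg hU hi) φ hU

theorem eq_nielsenCentralizer : K = nielsenCentralizer := by
  refine le_antisymm hK.le fun φ hφ => ?_
  obtain ⟨g, g', hg | hg⟩ := exists_apply_of_zero hφ
  · exact hK.mem_of_apply_of_zero hφ hg
  · refine (Subgroup.mul_mem_cancel_right _ hK.flip_mem).1
      (hK.mem_of_apply_of_zero (mul_mem hφ flipAut_mem) (g := g'⁻¹) (g' := g⁻¹) ?_)
    simp [flipAut, hg, mul_assoc]

end IsLarge

end FreeGroup

/-- A commutative group generated by three involutions that are separated by characters is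
elementary abelian of rank three. -/
theorem nonempty_mulEquiv_of_closure_eq_top {A : Type*} [CommGroup A] {x y z : A}
    (h : Subgroup.closure {x, y, z} = ⊤) (hx : x ^ 2 = 1) (hy : y ^ 2 = 1) (hz : z ^ 2 = 1)
    {χ₁ χ₂ χ₃ : A →* ℤˣ} (h₁ : (χ₁ x, χ₁ y, χ₁ z) = (-1, 1, 1))
    (h₂ : (χ₂ x, χ₂ y, χ₂ z) = (1, -1, 1)) (h₃ : (χ₃ x, χ₃ y, χ₃ z) = (1, 1, -1)) :
    Nonempty (A ≃* Multiplicative (ZMod 2 × ZMod 2 × ZMod 2)) := by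
  simp only [Prod.mk.injEq] at h₁ h₂ h₃
  have pow_val {a : A} (ha : a ^ 2 = 1) (i j : ZMod 2) :
      a ^ (i + j).val = a ^ i.val * a ^ j.val := by
    rw [ZMod.val_add, ← pow_add, ← pow_eq_pow_mod _ ha]
  let f : Multiplicative (ZMod 2 × ZMod 2 × ZMod 2) →* A :=
    MonoidHom.mk' (fun v => x ^ v.toAdd.1.val * (y ^ v.toAdd.2.1.val * z ^ v.toAdd.2.2.val))
      fun v w => by
        simp only [toAdd_mul, Prod.fst_add, Prod.snd_add, pow_val hx, pow_val hy, pow_val hz]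
        rw [mul_mul_mul_comm (y ^ _), mul_mul_mul_comm]
  have hf (v) : f v = x ^ v.toAdd.1.val * (y ^ v.toAdd.2.1.val * z ^ v.toAdd.2.2.val) := rfl
  have neg_one (i : ZMod 2) (hi : (-1 : ℤˣ) ^ i.val = 1) : i = 0 := by
    revert i; decide
  refine ⟨(MulEquiv.ofBijective f ⟨(injective_iff_map_eq_one f).2 fun v hv => ?_,
    MonoidHom.range_eq_top.1 (top_le_iff.1 ?_)⟩).symm⟩
  · rw [hf] at hv
    have e₁ := congrArg χ₁ hv
    have e₂ := congrArg χ₂ hv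
    have e₃ := congrArg χ₃ hv
    simp only [map_mul, map_pow, h₁, h₂, h₃, one_pow, one_mul, mul_one, map_one] at e₁ e₂ e₃
    exact Prod.ext (neg_one _ e₁) (Prod.ext (neg_one _ e₂) (neg_one _ e₃))
  · rw [← h, Subgroup.closure_le]
    rintro a (rfl | rfl | rfl)
    · exact ⟨.ofAdd (1, 0, 0), by simp [hf, ZMod.val_one]⟩
    · exact ⟨.ofAdd (0, 1, 0), by simp [hf, ZMod.val_one]⟩
    · exact ⟨.ofAdd (0, 0, 1), by simp [hf, ZMod.val_one]⟩

namespace FreeGroup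

section AbelianizationMatrix

variable {α : Type*} [DecidableEq α] [Fintype α]

theorem toAdd_expSum_apply (φ : MulAut (FreeGroup α)) (j : α) (w : FreeGroup α) :
    Multiplicative.toAdd (expSum j (φ w)) =
      ∑ k, Multiplicative.toAdd (expSum j (φ (of k))) * Multiplicative.toAdd (expSum k w) := by
  induction w using FreeGroup.induction_on with
  | C1 => simp
  | of i => simp
  | inv_of i h => simp
  | mul x y hx hy =>
    simp only [_root_.map_mul, toAdd_mul, hx, hy, mul_add, Finset.sum_add_distrib]

/-- The matrix of the action of an automorphism on the abelianization. -/
def abMatrix : MulAut (FreeGroup α) →* Matrix α α ℤ where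
  toFun φ := .of fun j i => Multiplicative.toAdd (expSum j (φ (of i)))
  map_one' := by
    ext j i
    simp [Matrix.one_apply, eq_comm]
  map_mul' φ ψ := by
    ext j i
    simp only [Matrix.of_apply, MulAut.mul_apply, Matrix.mul_apply]
    exact toAdd_expSum_apply φ j (ψ (of i))

theorem abMatrix_apply (φ : MulAut (FreeGroup α)) (j i : α) :
    abMatrix φ j i = Multiplicative.toAdd (expSum j (φ (of i))) := rfl

end AbelianizationMatrix

section Characters

theorem abMatrix_eq_zero {φ : MulAut (FreeGroup (Fin 4))} (hφ : φ ∈ nielsenCentralizer) :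
    (∀ j, j ≠ 1 → abMatrix φ j 1 = 0) ∧ ∀ i, i ≠ 0 → abMatrix φ 0 i = 0 := by
  have hn : abMatrix nielsenAut = 1 + Matrix.single 1 0 1 := by
    ext j i
    rw [abMatrix_apply]
    fin_cases j <;> fin_cases i <;>
      simp [nielsenAut]
  have h := congrArg abMatrix (Subgroup.mem_centralizer_singleton_iff.1 hφ)
  rw [_root_.map_mul, _root_.map_mul, hn, mul_add, add_mul, mul_one, one_mul, add_right_inj] at h
  refine ⟨fun j hj => ?_, fun i hi => ?_⟩
  · simpa [hj] using congrFun₂ h j 0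
  · simpa [hi] using (congrFun₂ h 1 i).symm

theorem abMatrix_mul_apply (φ ψ : MulAut (FreeGroup (Fin 4))) (j i : Fin 4) :
    abMatrix (φ * ψ) j i = abMatrix φ j 0 * abMatrix ψ 0 i + abMatrix φ j 1 * abMatrix ψ 1 i +
      abMatrix φ j 2 * abMatrix ψ 2 i + abMatrix φ j 3 * abMatrix ψ 3 i := by
  rw [_root_.map_mul, Matrix.mul_apply, Fin.sum_univ_four]

/-- The action on the conjugacy class of `b`. -/
def entryHom : nielsenCentralizer →* ℤ where
  toFun φ := abMatrix φ.1 1 1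
  map_one' := by simp
  map_mul' φ ψ := by
    have h := abMatrix_eq_zero ψ.2
    simp [abMatrix_mul_apply, h.1]

/-- The action on the abelianization modulo `a` and `b`. -/
def blockHom : nielsenCentralizer →* Matrix (Fin 2) (Fin 2) ℤ where
  toFun φ := (abMatrix φ.1).submatrix ![2, 3] ![2, 3]
  map_one' := by
    ext j i
    fin_cases j <;> fin_cases i <;> simp [Matrix.one_apply]
  map_mul' φ ψ := by
    have h := abMatrix_eq_zero φ.2
    have h' := abMatrix_eq_zero ψ.2
    have h1 (j : Fin 2) : (![2, 3] : Fin 2 → Fin 4) j ≠ 1 := by revert j; decide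
    have h0 (i : Fin 2) : (![2, 3] : Fin 2 → Fin 4) i ≠ 0 := by revert i; decide
    ext j i
    simp only [Subgroup.coe_mul, Matrix.submatrix_apply, abMatrix_mul_apply, h.1 _ (h1 j),
      h'.2 _ (h0 i), Matrix.mul_apply, Fin.sum_univ_two]
    simp

theorem blockHom_apply (φ : nielsenCentralizer) (j i : Fin 2) :
    blockHom φ j i = abMatrix φ.1 (![2, 3] j) (![2, 3] i) := rfl

/-- The sign of the permutation of the nonzero vectors of `𝔽₂²` induced by an invertible
matrix. -/
def signModTwo : (Matrix (Fin 2) (Fin 2) (ZMod 2))ˣ →* ℤˣ :=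
  MonoidHom.mk' (fun m => if m.1 0 0 * m.1 0 1 + m.1 1 0 * m.1 1 1 + m.1 0 1 * m.1 1 0 = 0
    then 1 else -1) fun m n => by
    have key : ∀ p q r s : ZMod 2, p * s - q * r ≠ 0 → ∀ p' q' r' s' : ZMod 2,
        p' * s' - q' * r' ≠ 0 →
        (if (p * p' + q * r') * (p * q' + q * s') + (r * p' + s * r') * (r * q' + s * s') +
          (p * q' + q * s') * (r * p' + s * r') = 0 then (1 : ℤˣ) else -1) =
        (if p * q + r * s + q * r = 0 then 1 else -1) *
          (if p' * q' + r' * s' + q' * r' = 0 then 1 else -1) := by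
      decide
    have hdet (u : (Matrix (Fin 2) (Fin 2) (ZMod 2))ˣ) :
        u.1 0 0 * u.1 1 1 - u.1 0 1 * u.1 1 0 ≠ 0 := by
      rw [← Matrix.det_fin_two]
      exact ((Matrix.isUnit_iff_isUnit_det _).1 u.isUnit).ne_zero
    simpa only [Units.val_mul, Matrix.mul_apply, Fin.sum_univ_two] using
      key _ _ _ _ (hdet m) _ _ _ _ (hdet n)

end Characters

/-- The transvection `c ↦ cd`, as an element of the centralizer. -/
def transvection : nielsenCentralizer :=
  ⟨rightTransvection (i := 2) (j := 3) (by decide),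
    rightTransvection_mem _ (by decide) (by decide) (by decide)⟩

/-- The classes of the inversion, the transvection and the flip generate the abelianization of
the centralizer. -/
theorem closure_abelianization_nielsenCentralizer :
    Subgroup.closure {Abelianization.of (⟨inversionAut, inversionAut_mem⟩ : nielsenCentralizer),
      Abelianization.of transvection,
      Abelianization.of (⟨flipAut, flipAut_mem⟩ : nielsenCentralizer)} = ⊤ := by
  set H : Subgroup (Abelianization nielsenCentralizer) := Subgroup.closure _
  have hK : IsLarge ((H.comap Abelianization.of).map nielsenCentralizer.subtype) :=
    { le := Subgroup.map_subtype_le _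
      commutator_mem := fun φ hφ ψ hψ => by
        refine ⟨⟨φ, hφ⟩ * ⟨ψ, hψ⟩ * ⟨φ, hφ⟩⁻¹ * ⟨ψ, hψ⟩⁻¹, ?_, rfl⟩
        simp only [Subgroup.coe_comap, Set.mem_preimage, _root_.map_mul, _root_.map_inv]
        rw [mul_inv_cancel_comm, mul_inv_cancel]
        exact one_mem _
      inversion_mem := ⟨⟨_, inversionAut_mem⟩, Subgroup.subset_closure (by simp), rfl⟩
      flip_mem := ⟨⟨_, flipAut_mem⟩, Subgroup.subset_closure (by simp), rfl⟩
      transvection_mem := ⟨transvection, Subgroup.subset_closure (by simp), rfl⟩ }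
  refine top_le_iff.1 fun a _ => ?_
  obtain ⟨φ, rfl⟩ := QuotientGroup.mk_surjective a
  obtain ⟨ψ, hψ, e⟩ := hK.eq_nielsenCentralizer.ge φ.2
  obtain rfl := Subtype.ext e
  exact hψ

theorem nonempty_abelianization_nielsenCentralizer_mulEquiv :
    Nonempty (Abelianization nielsenCentralizer ≃* Multiplicative (ZMod 2 × ZMod 2 × ZMod 2)) := by
  refine nonempty_mulEquiv_of_closure_eq_top closure_abelianization_nielsenCentralizer ?_ ?_ ?_
    (χ₁ := Abelianization.lift (Matrix.detMonoidHom.comp blockHom).toHomUnits)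
    (χ₂ := Abelianization.lift (signModTwo.comp
      ((Int.castRingHom (ZMod 2)).mapMatrix.toMonoidHom.comp blockHom).toHomUnits))
    (χ₃ := Abelianization.lift entryHom.toHomUnits) ?_ ?_ ?_
  · rw [← _root_.map_pow, pow_two]
    exact (congrArg _ (Subtype.ext inversionAut_mul_self)).trans (_root_.map_one _)
  · have hs : swapAut * inversionAut * swapAut ∈ nielsenCentralizer :=
      mul_mem (mul_mem swapAut_mem inversionAut_mem) swapAut_mem
    have h1 : (⟨_, hs⟩ * ⟨_, hs⟩ : nielsenCentralizer) = 1 :=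
      Subtype.ext (mulAut_ext (by simp [Fin.forall_fin_succ, swapAut, inversionAut]))
    have h2 : (⟨_, hs⟩ * transvection * (⟨_, hs⟩ * transvection) : nielsenCentralizer) = 1 :=
      Subtype.ext (mulAut_ext
        (by simp [Fin.forall_fin_succ, swapAut, inversionAut, transvection]))
    have h3 := congrArg Abelianization.of h1
    have h4 := congrArg Abelianization.of h2
    simp only [_root_.map_mul, _root_.map_one] at h3 h4
    rwa [mul_mul_mul_comm, h3, one_mul, ← pow_two] at h4
  · rw [← _root_.map_pow, pow_two]
    exact (congrArg _ (Subtype.ext flipAut_mul_self)).trans (_root_.map_one _)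
  · simp only [Abelianization.lift_apply_of, Prod.mk.injEq]
    refine ⟨?_, ?_, ?_⟩ <;> ext <;>
      simp [blockHom_apply, abMatrix_apply, Matrix.det_fin_two, inversionAut, flipAut, transvection]
  · simp only [Abelianization.lift_apply_of, Prod.mk.injEq]
    refine ⟨?_, ?_, ?_⟩ <;> ext <;>
      simp [signModTwo, blockHom_apply, abMatrix_apply, inversionAut, flipAut, transvection]
  · simp only [Abelianization.lift_apply_of, Prod.mk.injEq]
    refine ⟨?_, ?_, ?_⟩ <;> ext <;>
      simp [entryHom, abMatrix_apply, inversionAut, flipAut, transvection]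

end FreeGroup

/-- for `n = 4` (free group on `{a, b, c₁, c₂}`, with `a = of 0`,
`b = of 1`, `cᵢ = of (i+1)`), the abelianization of the centralizer of the Nielsen
automorphism `ρ : a ↦ ab, b ↦ b, cᵢ ↦ cᵢ` is isomorphic to `(ℤ/2ℤ)³`. -/
theorem nielsen_centralizer_abelianization_n4
    (ρ : MulAut (FreeGroup (Fin 4)))
    (hρa : ρ (FreeGroup.of 0) = FreeGroup.of 0 * FreeGroup.of 1)
    (hρ : ∀ i : Fin 4, i ≠ 0 → ρ (FreeGroup.of i) = FreeGroup.of i) :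
    Nonempty (Abelianization (Subgroup.centralizer {ρ}) ≃*
      Multiplicative (ZMod 2 × ZMod 2 × ZMod 2)) := by
  obtain rfl : ρ = FreeGroup.nielsenAut := FreeGroup.mulAut_ext fun i => by
    fin_cases i <;> simp [FreeGroup.nielsenAut, hρa, hρ]
  exact FreeGroup.nonempty_abelianization_nielsenCentralizer_mulEquiv
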